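/- Suppose g is not of type A_{2p}, and set d_K = ht(θ) + 1 − Σ_{α ∈ Π_K(-1)} [θ:α] = 1 + Σ_{α ∈ Π_K(0) ∪ Π_K(1)} [θ:α]. Then: (i) a positive root γ satisfies ht(γ) = d_K if and only if w_K^{-1}(γ) ∈ Π_K(-1); (ii) ht(γ) = d_K − 1 if and only if −w_K^{-1}(γ) ∈ Π_K(1); (iii) the set of roots of the abelian ideal a_K is Δ(a_K) = {γ ∈ Δ⁺ : ht(γ) ≥ d_K}. -/

import Mathlib

open scoped RealInnerProductSpace

attribute [local instance] Classical.propDecidable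

section RootCombinatorics

variable {V : Type*} [NormedAddCommGroup V] [InnerProductSpace ℝ V]

/-- The Cartan pairing `⟨γ, α∨⟩ = 2 (γ, α) / (α, α)`. -/
noncomputable def cartanPairing (γ α : V) : ℝ := 2 * ⟪γ, α⟫ / ⟪α, α⟫

/-- The coroot `γ∨ = 2 γ / (γ, γ)`. -/
noncomputable def covec (γ : V) : V := (2 / ⟪γ, γ⟫) • γ

/-- The cascade element `x_K = Σ_{β ∈ K} β / (β, β) = ½ Σ_{β ∈ K} β∨`. -/
noncomputable def cascElt (K : Finset V) : V := ∑ β ∈ K, (⟪β, β⟫)⁻¹ • β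

/-- The roots of `S` orthogonal to `β`. -/
noncomputable def orthSub (S : Finset V) (β : V) : Finset V := S.filter fun γ => ⟪γ, β⟫ = 0

/-- One step of the non-orthogonality (connectedness) relation inside `S`. -/
def connRel (S : Finset V) (a b : V) : Prop := a ∈ S ∧ b ∈ S ∧ ⟪a, b⟫ ≠ 0

/-- The irreducible component of the root subsystem `S` containing `γ`. -/
noncomputable def component (S : Finset V) (γ : V) : Finset V :=
  S.filter fun γ' => Relation.ReflTransGen (connRel S) γ γ'

/-- `C` is an irreducible component of the root subsystem `S`. -/
def IsComponent (S C : Finset V) : Prop := ∃ γ ∈ S, C = component S γ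

end RootCombinatorics

/-- The combinatorial data of an irreducible crystallographic root system with a chosen
system of positive roots, base (set of simple roots) and highest root: the combinatorial
skeleton of a finite-dimensional complex simple Lie algebra, with the Killing-form
identification of the Cartan subalgebra and its dual. -/
structure RootSystemCtx (V : Type*) [NormedAddCommGroup V] [InnerProductSpace ℝ V] where
  /-- the set of roots Δ -/
  Δ : Finset V
  /-- the set of simple roots Π -/
  base : Finset V
  /-- the set of positive roots Δ⁺ -/
  Pos : Finset V
  /-- the highest root θ -/
  θ : V
  zero_not_mem : (0 : V) ∉ Δ
  neg_mem : ∀ γ ∈ Δ, -γ ∈ Δ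
  reflect_mem : ∀ α ∈ Δ, ∀ γ ∈ Δ, γ - cartanPairing γ α • α ∈ Δ
  pairing_int : ∀ α ∈ Δ, ∀ γ ∈ Δ, ∃ k : ℤ, cartanPairing γ α = (k : ℝ)
  span_eq : Submodule.span ℝ (Δ : Set V) = ⊤
  base_subset : base ⊆ Pos
  base_indep : LinearIndependent ℝ (fun a : {x // x ∈ base} => (a : V))
  pos_subset : Pos ⊆ Δ
  pos_or_neg : ∀ γ ∈ Δ, γ ∈ Pos ∨ -γ ∈ Pos
  pos_not_neg : ∀ γ ∈ Pos, -γ ∉ Pos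
  pos_coords : ∀ γ ∈ Pos, γ ∈ AddSubmonoid.closure (base : Set V)
  irreducible : ∀ S : Finset V, S ⊆ Δ → S.Nonempty →
    (∀ a ∈ S, ∀ b ∈ Δ, b ∉ S → ⟪a, b⟫ = 0) → S = Δ
  theta_mem : θ ∈ Pos
  theta_highest : ∀ γ ∈ Δ, θ - γ ∈ AddSubmonoid.closure (base : Set V)

namespace RootSystemCtx

variable {V : Type*} [NormedAddCommGroup V] [InnerProductSpace ℝ V]

variable (ctx : RootSystemCtx V)

/-- The root order `γ ≼ γ'` on roots: `γ' - γ` is a nonnegative integral combination of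
simple roots. -/
def rootLE (γ γ' : V) : Prop := γ' - γ ∈ AddSubmonoid.closure (ctx.base : Set V)

/-- `β` is the highest root of the root subsystem `S` (with respect to the ambient positive
system). -/
def IsHighest (S : Finset V) (β : V) : Prop :=
  β ∈ S ∧ β ∈ ctx.Pos ∧ ∀ γ ∈ S, ctx.rootLE γ β

/-- `CascadeMem ctx S β` : the pair (root subsystem `S = Δ⟨i⟩`, its highest root `β = βᵢ`)
occurs in the recursive construction of the Kostant cascade: one starts with `(Δ, θ)`, and the
descendants of `(S, β)` are the pairs `(C, β')` where `C` is an irreducible component of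
`{γ ∈ S | (γ, β) = 0}` and `β'` is the highest root of `C`. -/
inductive CascadeMem : Finset V → V → Prop
  | top : CascadeMem ctx.Δ ctx.θ
  | step {S C : Finset V} {β β' : V} : CascadeMem S β →
      IsComponent (orthSub S β) C → ctx.IsHighest C β' → CascadeMem C β'

/-- `K` is the Kostant cascade of the root system. -/
def IsCascade (K : Finset V) : Prop := ∀ β, β ∈ K ↔ ∃ S, ctx.CascadeMem S β

/-- The Heisenberg subset `H_β = {γ ∈ S ∩ Δ⁺ : (γ, β) > 0}` attached to a cascade pair
`(S, β)`. -/
noncomputable def heis (S : Finset V) (β : V) : Finset V :=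
  S.filter fun γ => γ ∈ ctx.Pos ∧ 0 < ⟪γ, β⟫

/-- A root is long if it has the same length as the highest root. -/
def IsLong (γ : V) : Prop := ⟪γ, γ⟫ = ⟪ctx.θ, ctx.θ⟫

/-- The highest root `θ` is a fundamental weight. -/
def ThetaFundamental : Prop :=
  ∃ α ∈ ctx.base, cartanPairing ctx.θ α = 1 ∧
    ∀ β ∈ ctx.base, β ≠ α → cartanPairing ctx.θ β = 0

/-- `β'` is a descendant of the cascade element `β`. -/
def Desc (β β' : V) : Prop :=
  ∃ S C, ctx.CascadeMem S β ∧ IsComponent (orthSub S β) C ∧ ctx.IsHighest C β'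

/-- The cascade poset order: `β ≤ β'` iff `β` is an iterated descendant of `β'`. -/
def cascLE (β β' : V) : Prop := Relation.ReflTransGen (fun a b => ctx.Desc b a) β β'

/-- A simple reflection of the root system. -/
def IsSimpleReflection (w : V ≃ₗ[ℝ] V) : Prop :=
  ∃ α ∈ ctx.base, ∀ v, w v = v - (2 * ⟪v, α⟫ / ⟪α, α⟫) • α

/-- The Weyl group, generated by the simple reflections. -/
def weylGroup : Subgroup (V ≃ₗ[ℝ] V) := Subgroup.closure {w | ctx.IsSimpleReflection w}

/-- The length of a Weyl group element: the minimal number of simple reflections needed to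
express it. -/
noncomputable def length (w : V ≃ₗ[ℝ] V) : ℕ :=
  sInf {n | ∃ l : List (V ≃ₗ[ℝ] V), l.length = n ∧
    (∀ s ∈ l, ctx.IsSimpleReflection s) ∧ l.prod = w}

/-- The root system is of type `Aₙ` (Cartan matrix characterisation). -/
def IsTypeA (n : ℕ) : Prop :=
  1 ≤ n ∧ ∃ e : Fin n ≃ {x // x ∈ ctx.base}, ∀ i j : Fin n,
    cartanPairing (e i : V) (e j : V) =
      (if i = j then 2 else if i.val + 1 = j.val ∨ j.val + 1 = i.val then -1 else 0)

/-- The root system is of type `Bₙ` (`n ≥ 2`), with the last simple root short. -/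
def IsTypeB (n : ℕ) : Prop :=
  2 ≤ n ∧ ∃ e : Fin n ≃ {x // x ∈ ctx.base}, ∀ i j : Fin n,
    cartanPairing (e i : V) (e j : V) =
      (if i = j then 2
       else if i.val + 2 = n ∧ j.val + 1 = n then -2
       else if i.val + 1 = j.val ∨ j.val + 1 = i.val then -1 else 0)

/-- The root system is of type `Cₙ` (`n ≥ 2`), with the last simple root long. -/
def IsTypeC (n : ℕ) : Prop :=
  2 ≤ n ∧ ∃ e : Fin n ≃ {x // x ∈ ctx.base}, ∀ i j : Fin n,
    cartanPairing (e i : V) (e j : V) =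
      (if i = j then 2
       else if i.val + 1 = n ∧ j.val + 2 = n then -2
       else if i.val + 1 = j.val ∨ j.val + 1 = i.val then -1 else 0)

/-- The root system is of type `G₂` (first simple root short). -/
def IsTypeG2 : Prop :=
  ∃ e : Fin 2 ≃ {x // x ∈ ctx.base},
    cartanPairing (e 0 : V) (e 0 : V) = 2 ∧ cartanPairing (e 1 : V) (e 1 : V) = 2 ∧
    cartanPairing (e 0 : V) (e 1 : V) = -1 ∧ cartanPairing (e 1 : V) (e 0 : V) = -3

/-- The set of roots `Δ(a_z) = w(Δ⁺_z(-1)) ∪ w(-Δ⁺_z(2))` of the abelian ideal attached by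
Kostant's construction to `z` (with `w = w_z`). -/
def idealSet (w : V ≃ₗ[ℝ] V) (x : V) : Set V :=
  {δ | ∃ γ ∈ ctx.Pos, (⟪γ, x⟫ = -1 ∧ δ = w γ) ∨ (⟪γ, x⟫ = 2 ∧ δ = -(w γ))}

end RootSystemCtx

namespace RootSystemCtx

variable {V : Type*} [NormedAddCommGroup V] [InnerProductSpace ℝ V]

/-! ### Root subsystems -/

/-- A finite set of nonzero vectors that is stable under its own reflections and has integral
Cartan pairings. -/
structure IsSubsystem (S : Finset V) : Prop where
  ne_zero : ∀ γ ∈ S, γ ≠ 0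
  reflect : ∀ α ∈ S, ∀ γ ∈ S, γ - cartanPairing γ α • α ∈ S
  integral : ∀ α ∈ S, ∀ γ ∈ S, ∃ k : ℤ, cartanPairing γ α = k

theorem inner_self_pos_of_ne {γ : V} (h : γ ≠ 0) : 0 < ⟪γ, γ⟫ :=
  real_inner_self_pos.2 h

theorem cartanPairing_mul_inner_self (γ : V) {α : V} (h : α ≠ 0) :
    cartanPairing γ α * ⟪α, α⟫ = 2 * ⟪γ, α⟫ := by
  have := (inner_self_pos_of_ne h).ne'
  unfold cartanPairing
  field_simp

theorem cartanPairing_self {γ : V} (h : γ ≠ 0) : cartanPairing γ γ = 2 := by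
  have := (inner_self_pos_of_ne h).ne'
  unfold cartanPairing
  field_simp

theorem cartanPairing_add_left (γ γ' α : V) :
    cartanPairing (γ + γ') α = cartanPairing γ α + cartanPairing γ' α := by
  unfold cartanPairing
  rw [inner_add_left]
  ring

theorem cartanPairing_pos_iff {γ α : V} (h : α ≠ 0) :
    0 < cartanPairing γ α ↔ 0 < ⟪γ, α⟫ := by
  have h1 := cartanPairing_mul_inner_self γ h
  have h2 := inner_self_pos_of_ne h
  constructor
  · intro h3
    nlinarith [mul_pos h3 h2]
  · intro h3
    by_contra! h4
    nlinarith [mul_nonneg_of_nonpos_of_nonpos h4 (neg_nonpos.2 h2.le)]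

theorem cartanPairing_eq_zero_iff {γ α : V} (h : α ≠ 0) :
    cartanPairing γ α = 0 ↔ ⟪γ, α⟫ = 0 := by
  have h1 := cartanPairing_mul_inner_self γ h
  have h2 := inner_self_pos_of_ne h
  constructor
  · intro h3
    rw [h3] at h1
    linarith
  · intro h3
    rw [h3, mul_zero] at h1
    exact (mul_eq_zero.1 h1).resolve_right h2.ne'

theorem cartanPairing_mul_swap_le {a b : V} (ha : a ≠ 0) (hb : b ≠ 0) :
    cartanPairing a b * cartanPairing b a ≤ 4 := by
  have h1 := cartanPairing_mul_inner_self a hb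
  have h2 := cartanPairing_mul_inner_self b ha
  have h3 := inner_self_pos_of_ne ha
  have h4 := inner_self_pos_of_ne hb
  have h5 := real_inner_mul_inner_self_le a b
  rw [real_inner_comm a b] at h2
  by_contra! h6
  have h7 : (cartanPairing a b * cartanPairing b a) * (⟪a, a⟫ * ⟪b, b⟫) =
      4 * (⟪a, b⟫ * ⟪a, b⟫) := by
    linear_combination (cartanPairing b a * ⟪a, a⟫) * h1 + 2 * ⟪a, b⟫ * h2
  nlinarith [mul_pos h3 h4, mul_lt_mul_of_pos_right h6 (mul_pos h3 h4)]

namespace IsSubsystem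

variable {S : Finset V}

theorem neg_mem (hS : IsSubsystem S) {γ : V} (h : γ ∈ S) : -γ ∈ S := by
  have := hS.reflect γ h γ h
  rw [cartanPairing_self (hS.ne_zero γ h), two_smul] at this
  simpa using this

/-- If two distinct roots make an acute angle, their difference is a root. -/
theorem sub_mem (hS : IsSubsystem S) {a b : V} (ha : a ∈ S) (hb : b ∈ S)
    (hab : 0 < ⟪a, b⟫) (hne : a ≠ b) : a - b ∈ S := by
  have ha0 := hS.ne_zero a ha
  have hb0 := hS.ne_zero b hb
  obtain ⟨k, hk⟩ := hS.integral b hb a ha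
  obtain ⟨l, hl⟩ := hS.integral a ha b hb
  have hk0 : 0 < k := by
    have := (cartanPairing_pos_iff hb0).2 hab
    rw [hk] at this
    exact_mod_cast this
  have hl0 : 0 < l := by
    have := (cartanPairing_pos_iff (γ := b) ha0).2 (by rwa [real_inner_comm])
    rw [hl] at this
    exact_mod_cast this
  have hkl : k * l ≤ 4 := by
    have := cartanPairing_mul_swap_le ha0 hb0
    rw [hk, hl] at this
    exact_mod_cast this
  by_cases hk1 : k = 1
  · have := hS.reflect b hb a ha
    rw [hk, hk1] at this
    simpa using this
  by_cases hl1 : l = 1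
  · have := hS.neg_mem (hS.reflect a ha b hb)
    rw [hl, hl1] at this
    simpa using this
  have hk2 : k = 2 := by nlinarith [show 2 ≤ k by omega, show 2 ≤ l by omega]
  have hl2 : l = 2 := by nlinarith [show 2 ≤ k by omega, show 2 ≤ l by omega]
  have h1 := cartanPairing_mul_inner_self a hb0
  have h2 := cartanPairing_mul_inner_self b ha0
  rw [hk, hk2] at h1
  rw [hl, hl2, real_inner_comm a b] at h2
  push_cast at h1 h2
  exfalso
  apply hne
  rw [← sub_eq_zero, ← inner_self_eq_zero (𝕜 := ℝ), inner_sub_left, inner_sub_right,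
    inner_sub_right, real_inner_comm a b]
  linarith

theorem add_mem (hS : IsSubsystem S) {a b : V} (ha : a ∈ S) (hb : b ∈ S)
    (hab : ⟪a, b⟫ < 0) (hne : a + b ≠ 0) : a + b ∈ S := by
  have := hS.sub_mem ha (hS.neg_mem hb) (by rw [inner_neg_right]; linarith)
    (fun h => hne (by rw [h]; simp))
  simpa using this

theorem orthSub (hS : IsSubsystem S) (β : V) : IsSubsystem (orthSub S β) where
  ne_zero γ h := hS.ne_zero γ (Finset.mem_filter.1 h).1
  integral α hα γ hγ :=
    hS.integral α (Finset.mem_filter.1 hα).1 γ (Finset.mem_filter.1 hγ).1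
  reflect α hα γ hγ := by
    obtain ⟨hα, h1⟩ := Finset.mem_filter.1 hα
    obtain ⟨hγ, h2⟩ := Finset.mem_filter.1 hγ
    refine Finset.mem_filter.2 ⟨hS.reflect α hα γ hγ, ?_⟩
    rw [inner_sub_left, inner_smul_left, h1, h2]
    simp

end IsSubsystem

theorem mem_orthSub {S : Finset V} {β γ : V} : γ ∈ orthSub S β ↔ γ ∈ S ∧ ⟪γ, β⟫ = 0 :=
  Finset.mem_filter

theorem connRel_symm {S : Finset V} {a b : V} (h : connRel S a b) : connRel S b a :=
  ⟨h.2.1, h.1, by rw [real_inner_comm]; exact h.2.2⟩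

theorem reflTransGen_connRel_symm {S : Finset V} {a b : V}
    (h : Relation.ReflTransGen (connRel S) a b) : Relation.ReflTransGen (connRel S) b a := by
  induction h with
  | refl => exact .refl
  | tail _ h ih => exact .head (connRel_symm h) ih

theorem _root_.IsComponent.subset {S C : Finset V} (h : IsComponent S C) : C ⊆ S := by
  obtain ⟨γ, _, rfl⟩ := h
  exact Finset.filter_subset _ _

theorem isComponent_component {S : Finset V} {γ : V} (h : γ ∈ S) :
    IsComponent S (component S γ) := ⟨γ, h, rfl⟩

theorem mem_component_self {S : Finset V} {γ : V} (h : γ ∈ S) : γ ∈ component S γ :=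
  Finset.mem_filter.2 ⟨h, .refl⟩

theorem _root_.IsComponent.reachable {S C : Finset V} (h : IsComponent S C) {a b : V} (ha : a ∈ C)
    (hb : b ∈ C) : Relation.ReflTransGen (connRel S) a b := by
  obtain ⟨γ, _, rfl⟩ := h
  exact (reflTransGen_connRel_symm (Finset.mem_filter.1 ha).2).trans (Finset.mem_filter.1 hb).2

theorem _root_.IsComponent.mem_of_inner_ne {S C : Finset V} (h : IsComponent S C) {a b : V}
    (ha : a ∈ C) (hb : b ∈ S) (hab : ⟪a, b⟫ ≠ 0) : b ∈ C := by
  obtain ⟨γ, _, rfl⟩ := h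
  obtain ⟨ha, h1⟩ := Finset.mem_filter.1 ha
  exact Finset.mem_filter.2 ⟨hb, h1.tail ⟨ha, hb, hab⟩⟩

theorem _root_.IsComponent.eq_or_orthogonal {S C C' : Finset V} (h : IsComponent S C)
    (h' : IsComponent S C') : C = C' ∨ ∀ a ∈ C, ∀ b ∈ C', ⟪a, b⟫ = 0 := by
  by_contra! hcon
  obtain ⟨hne, a, ha, b, hb, hab⟩ := hcon
  apply hne
  have hb' := h.mem_of_inner_ne ha (h'.subset hb) hab
  have key : ∀ {D D' : Finset V}, IsComponent S D → IsComponent S D' → b ∈ D → b ∈ D' →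
      D ⊆ D' := by
    intro D D' hD hD' h1 h2 c hc
    have := hD.reachable h1 hc
    obtain ⟨γ, _, rfl⟩ := hD'
    exact Finset.mem_filter.2 ⟨hD.subset hc, (Finset.mem_filter.1 h2).2.trans this⟩
  exact Finset.Subset.antisymm (key h h' hb' hb) (key h' h hb hb')

theorem IsSubsystem.component {S C : Finset V} (hS : IsSubsystem S) (h : IsComponent S C) :
    IsSubsystem C where
  ne_zero γ hγ := hS.ne_zero γ (h.subset hγ)
  integral α hα γ hγ := hS.integral α (h.subset hα) γ (h.subset hγ)
  reflect α hα γ hγ := by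
    by_cases h0 : ⟪γ, α⟫ = 0
    · rwa [(cartanPairing_eq_zero_iff (hS.ne_zero α (h.subset hα))).2 h0, zero_smul, sub_zero]
    · apply h.mem_of_inner_ne hα (hS.reflect α (h.subset hα) γ (h.subset hγ))
      rw [inner_sub_right, inner_smul_right,
        cartanPairing_mul_inner_self γ (hS.ne_zero α (h.subset hα)), real_inner_comm γ α]
      intro h1
      apply h0
      linarith

/-- Two roots in the same irreducible component have a common non-orthogonal root. -/
theorem IsSubsystem.exists_common_neighbour {S : Finset V} (hS : IsSubsystem S) {a b : V}
    (ha : a ∈ S) (h : Relation.ReflTransGen (connRel S) a b) :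
    ∃ g ∈ S, ⟪a, g⟫ ≠ 0 ∧ ⟪g, b⟫ ≠ 0 := by
  induction h with
  | refl =>
    have := (inner_self_pos_of_ne (hS.ne_zero a ha)).ne'
    exact ⟨a, ha, this, this⟩
  | @tail b c _ hbc ih =>
    obtain ⟨g, hg, h1, h2⟩ := ih
    obtain ⟨hb, hc, hbc⟩ := hbc
    by_cases h3 : ⟪g, c⟫ = 0
    · by_cases h4 : ⟪a, b⟫ = 0
      · refine ⟨_, hS.reflect b hb g hg, ?_, ?_⟩
        · rw [inner_sub_right, inner_smul_right, h4]
          simpa using h1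
        · rw [inner_sub_left, inner_smul_left, h3, zero_sub]
          refine neg_ne_zero.2 (mul_ne_zero ?_ hbc)
          exact fun h => h2 ((cartanPairing_eq_zero_iff (hS.ne_zero b hb)).1 h)
      · exact ⟨b, hb, h4, hbc⟩
    · exact ⟨g, hg, h1, h3⟩

/-! ### Coordinates with respect to the simple roots -/

variable (ctx : RootSystemCtx V)

theorem isSubsystem_roots : IsSubsystem ctx.Δ where
  ne_zero _ h h0 := ctx.zero_not_mem (h0 ▸ h)
  reflect := ctx.reflect_mem
  integral := ctx.pairing_int

theorem span_base : Submodule.span ℝ (ctx.base : Set V) = ⊤ := by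
  rw [eq_top_iff, ← ctx.span_eq, Submodule.span_le]
  have key : ∀ γ ∈ ctx.Pos, γ ∈ Submodule.span ℝ (ctx.base : Set V) := fun γ hγ =>
    (AddSubmonoid.closure_le (S := (Submodule.span ℝ (ctx.base : Set V)).toAddSubmonoid)).2
      Submodule.subset_span (ctx.pos_coords γ hγ)
  intro γ hγ
  rcases ctx.pos_or_neg γ hγ with h | h
  · exact key γ h
  · simpa using Submodule.neg_mem _ (key _ h)

/-- The simple roots as a basis of the ambient space. -/
noncomputable def simpleBasis : Module.Basis {x // x ∈ ctx.base} ℝ V :=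
  Module.Basis.mk ctx.base_indep (by
    rw [Subtype.range_coe_subtype]
    exact ctx.span_base.ge)

/-- The coordinate `[γ : α]` of a vector at a simple root, as a linear functional. -/
noncomputable def coord (α : V) : V →ₗ[ℝ] ℝ :=
  if h : α ∈ ctx.base then ctx.simpleBasis.coord ⟨α, h⟩ else 0

theorem simpleBasis_apply (i : {x // x ∈ ctx.base}) : ctx.simpleBasis i = i := by
  simp [simpleBasis]

theorem coord_simple {α β : V} (hα : α ∈ ctx.base) (hβ : β ∈ ctx.base) :
    ctx.coord α β = ctx.simpleBasis.repr (ctx.simpleBasis ⟨β, hβ⟩) ⟨α, hα⟩ := by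
  rw [coord, dif_pos hα, Module.Basis.coord_apply, ctx.simpleBasis_apply]

theorem coord_self {α : V} (h : α ∈ ctx.base) : ctx.coord α α = 1 := by
  rw [ctx.coord_simple h h, Module.Basis.repr_self, Finsupp.single_eq_same]

theorem coord_of_ne {α β : V} (hα : α ∈ ctx.base) (hβ : β ∈ ctx.base) (hne : α ≠ β) :
    ctx.coord α β = 0 := by
  rw [ctx.coord_simple hα hβ, Module.Basis.repr_self, Finsupp.single_apply, if_neg]
  exact fun h => hne (congrArg Subtype.val h).symm

theorem sum_coord_smul (v : V) : ∑ α ∈ ctx.base, ctx.coord α v • α = v := by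
  rw [← Finset.sum_coe_sort]
  conv_rhs => rw [← ctx.simpleBasis.sum_repr v]
  refine Finset.sum_congr rfl fun i _ => ?_
  rw [coord, dif_pos i.2, ctx.simpleBasis_apply, Module.Basis.coord_apply]

/-- The height, as a linear functional. -/
noncomputable def height : V →ₗ[ℝ] ℝ := ∑ α ∈ ctx.base, ctx.coord α

theorem height_apply (v : V) : ctx.height v = ∑ α ∈ ctx.base, ctx.coord α v := by
  simp [height]

theorem height_simple {α : V} (h : α ∈ ctx.base) : ctx.height α = 1 := by
  rw [height_apply, Finset.sum_eq_single_of_mem α h, ctx.coord_self h]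
  exact fun β hβ hne => ctx.coord_of_ne hβ h hne

theorem map_eq_sum_coord (f : V →ₗ[ℝ] ℝ) (v : V) :
    f v = ∑ α ∈ ctx.base, ctx.coord α v * f α := by
  conv_lhs => rw [← ctx.sum_coord_smul v]
  simp

theorem inner_eq_sum_coord (u v : V) :
    ⟪u, v⟫ = ∑ α ∈ ctx.base, ctx.coord α u * ⟪α, v⟫ := by
  conv_lhs => rw [← ctx.sum_coord_smul u]
  simp [sum_inner, inner_smul_left]

theorem coord_eq_zero_or_one_le {v : V} (hv : v ∈ AddSubmonoid.closure (ctx.base : Set V))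
    (α : V) : ctx.coord α v = 0 ∨ 1 ≤ ctx.coord α v := by
  by_cases hα : α ∈ ctx.base
  · induction hv using AddSubmonoid.closure_induction with
    | mem β hβ =>
      by_cases h : α = β
      · subst h
        exact Or.inr (ctx.coord_self hα).ge
      · exact Or.inl (ctx.coord_of_ne hα hβ h)
    | zero => simp
    | add x y _ _ hx hy =>
      rw [map_add]
      rcases hx with hx | hx <;> rcases hy with hy | hy
      · left; linarith
      all_goals right; linarith
  · simp [coord, hα]

theorem coord_nonneg {v : V} (hv : v ∈ AddSubmonoid.closure (ctx.base : Set V)) (α : V) :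
    0 ≤ ctx.coord α v := by
  rcases ctx.coord_eq_zero_or_one_le hv α with h | h <;> linarith

theorem eq_of_coord_eq {u v : V} (h : ∀ α, ctx.coord α u = ctx.coord α v) : u = v := by
  rw [← ctx.sum_coord_smul u, ← ctx.sum_coord_smul v]
  simp [h]

theorem height_pos {v : V} (hv : v ∈ AddSubmonoid.closure (ctx.base : Set V)) :
    v = 0 ∨ 1 ≤ ctx.height v := by
  by_cases h : ∃ α ∈ ctx.base, ctx.coord α v ≠ 0
  · obtain ⟨α, hα, h⟩ := h
    right
    rw [height_apply]
    exact ((ctx.coord_eq_zero_or_one_le hv α).resolve_left h).trans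
      (Finset.single_le_sum (f := fun α => ctx.coord α v)
        (fun β _ => ctx.coord_nonneg hv β) hα)
  · push Not at h
    left
    rw [← ctx.sum_coord_smul v]
    exact Finset.sum_eq_zero fun α hα => by rw [h α hα, zero_smul]

theorem pos_ne_zero {γ : V} (h : γ ∈ ctx.Pos) : γ ≠ 0 :=
  ctx.isSubsystem_roots.ne_zero γ (ctx.pos_subset h)

theorem one_le_height {γ : V} (h : γ ∈ ctx.Pos) : 1 ≤ ctx.height γ :=
  (ctx.height_pos (ctx.pos_coords γ h)).resolve_left (ctx.pos_ne_zero h)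

theorem pos_coord_nonneg {γ : V} (h : γ ∈ ctx.Pos) (α : V) : 0 ≤ ctx.coord α γ :=
  ctx.coord_nonneg (ctx.pos_coords γ h) α

theorem simple_ne_add {α μ ν : V} (hα : α ∈ ctx.base) (hμ : μ ∈ ctx.Pos) (hν : ν ∈ ctx.Pos) :
    α ≠ μ + ν := by
  intro h
  have := ctx.height_simple hα
  rw [h, map_add] at this
  linarith [ctx.one_le_height hμ, ctx.one_le_height hν]

theorem pos_of_height_pos {γ : V} (h : γ ∈ ctx.Δ) (h0 : 0 < ctx.height γ) : γ ∈ ctx.Pos := by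
  refine (ctx.pos_or_neg γ h).resolve_right fun h1 => ?_
  have := ctx.one_le_height h1
  rw [map_neg] at this
  linarith

theorem add_pos_mem {a b : V} (ha : a ∈ ctx.Pos) (hb : b ∈ ctx.Pos) (hab : ⟪a, b⟫ < 0) :
    a + b ∈ ctx.Pos := by
  have h : 0 < ctx.height (a + b) := by
    rw [map_add]
    linarith [ctx.one_le_height ha, ctx.one_le_height hb]
  refine ctx.pos_of_height_pos (ctx.isSubsystem_roots.add_mem (ctx.pos_subset ha)
    (ctx.pos_subset hb) hab fun h0 => ?_) h
  rw [h0, map_zero] at h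
  exact lt_irrefl _ h

theorem sub_simple_pos {γ α : V} (hγ : γ ∈ ctx.Pos) (hα : α ∈ ctx.base)
    (h : γ - α ∈ ctx.Δ) : γ - α ∈ ctx.Pos := by
  refine (ctx.pos_or_neg _ h).resolve_right fun h1 => ?_
  exact ctx.simple_ne_add hα hγ h1 (by abel)

theorem inner_simple_nonpos {α β : V} (hα : α ∈ ctx.base) (hβ : β ∈ ctx.base) (hne : α ≠ β) :
    ⟪α, β⟫ ≤ 0 := by
  by_contra! h
  have h1 := ctx.sub_simple_pos (ctx.base_subset hα) hβ (ctx.isSubsystem_roots.sub_mem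
    (ctx.pos_subset (ctx.base_subset hα)) (ctx.pos_subset (ctx.base_subset hβ)) h hne)
  exact ctx.simple_ne_add hα h1 (ctx.base_subset hβ) (by abel)

/-- A positive root that is not simple stays positive after subtracting some simple root. -/
theorem exists_sub_simple {γ : V} (hγ : γ ∈ ctx.Pos) (hs : γ ∉ ctx.base) :
    ∃ α ∈ ctx.base, γ - α ∈ ctx.Pos := by
  have h0 := inner_self_pos_of_ne (ctx.pos_ne_zero hγ)
  rw [ctx.inner_eq_sum_coord] at h0
  obtain ⟨α, hα, h1⟩ := Finset.exists_lt_of_sum_lt (s := ctx.base) (f := fun _ => (0 : ℝ))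
    (by simpa using h0)
  have h2 : 0 < ⟪γ, α⟫ := by
    rw [real_inner_comm]
    exact pos_of_mul_pos_right h1 (ctx.pos_coord_nonneg hγ α)
  refine ⟨α, hα, ctx.sub_simple_pos hγ hα (ctx.isSubsystem_roots.sub_mem (ctx.pos_subset hγ)
    (ctx.pos_subset (ctx.base_subset hα)) h2 ?_)⟩
  rintro rfl
  exact hs hα

theorem mem_base_of_height_lt {γ : V} (hγ : γ ∈ ctx.Pos) (h : ctx.height γ < 2) :
    γ ∈ ctx.base := by
  by_contra hs
  obtain ⟨α, hα, h1⟩ := ctx.exists_sub_simple hγ hs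
  have := ctx.one_le_height h1
  rw [map_sub, ctx.height_simple hα] at this
  linarith

theorem rootLE_antisymm {a b : V} (h : ctx.rootLE a b) (h' : ctx.rootLE b a) : a = b := by
  refine ctx.eq_of_coord_eq fun α => ?_
  have h1 := ctx.coord_nonneg h α
  have h2 := ctx.coord_nonneg h' α
  rw [map_sub] at h1 h2
  linarith

theorem rootLE_trans {a b c : V} (h : ctx.rootLE a b) (h' : ctx.rootLE b c) :
    ctx.rootLE a c := by
  have := AddSubmonoid.add_mem _ h h'
  rwa [show b - a + (c - b) = c - a by abel] at this

/-- Every positive root is supported on one side of a partition of the simple roots into two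
mutually orthogonal parts. -/
theorem support_dichotomy (P : V → Prop)
    (hP : ∀ a ∈ ctx.base, ∀ b ∈ ctx.base, P a → ¬ P b → ⟪a, b⟫ = 0) (n : ℕ) :
    ∀ γ ∈ ctx.Pos, ctx.height γ < n →
      (∀ b ∈ ctx.base, ctx.coord b γ ≠ 0 → P b) ∨ ∀ b ∈ ctx.base, ctx.coord b γ ≠ 0 → ¬ P b := by
  induction n with
  | zero =>
    intro γ hγ h
    have := ctx.one_le_height hγ
    push_cast at h
    linarith
  | succ n ih =>
    intro γ hγ h
    by_cases hs : γ ∈ ctx.base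
    · have key : ∀ b ∈ ctx.base, ctx.coord b γ ≠ 0 → b = γ := fun b hb h => by
        by_contra hne
        exact h (ctx.coord_of_ne hb hs hne)
      by_cases hPγ : P γ
      · exact Or.inl fun b hb h => key b hb h ▸ hPγ
      · exact Or.inr fun b hb h => key b hb h ▸ hPγ
    · obtain ⟨α, hα, h1⟩ := ctx.exists_sub_simple hγ hs
      set δ := γ - α with hδ
      have hγδ : γ = δ + α := by rw [hδ]; abel
      have h2 : ctx.height δ < n := by
        rw [hδ, map_sub, ctx.height_simple hα]
        push_cast at h
        linarith
      have not_orth : ctx.coord α δ = 0 → ⟪δ, α⟫ ≠ 0 := by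
        intro h3 h4
        have hα0 := ctx.pos_ne_zero (ctx.base_subset hα)
        have h5 := ctx.reflect_mem α (ctx.pos_subset (ctx.base_subset hα)) γ (ctx.pos_subset hγ)
        rw [hγδ, cartanPairing_add_left, (cartanPairing_eq_zero_iff hα0).2 h4,
          cartanPairing_self hα0, zero_add, two_smul,
          show δ + α - (α + α) = δ - α by abel] at h5
        have h6 := ctx.pos_coord_nonneg (ctx.sub_simple_pos h1 hα h5) α
        rw [map_sub, ctx.coord_self hα, h3] at h6
        linarith
      have orth : (∀ b ∈ ctx.base, ctx.coord b δ ≠ 0 → ⟪b, α⟫ = 0) → ⟪δ, α⟫ = 0 := by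
        intro h3
        rw [ctx.inner_eq_sum_coord]
        refine Finset.sum_eq_zero fun b hb => ?_
        by_cases h4 : ctx.coord b δ = 0
        · rw [h4, zero_mul]
        · rw [h3 b hb h4, mul_zero]
      have supp : ∀ b ∈ ctx.base, ctx.coord b γ ≠ 0 → b = α ∨ ctx.coord b δ ≠ 0 := by
        intro b hb h3
        by_contra! h4
        apply h3
        rw [hγδ, map_add, h4.2, ctx.coord_of_ne hb hα h4.1, add_zero]
      rcases ih δ h1 h2 with h3 | h3
      · by_cases hPα : P α
        · left
          intro b hb h4
          rcases supp b hb h4 with rfl | h5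
          exacts [hPα, h3 b hb h5]
        · refine absurd (orth fun b hb h4 => hP b hb α hα (h3 b hb h4) hPα) (not_orth ?_)
          by_contra h4
          exact hPα (h3 α hα h4)
      · by_cases hPα : P α
        · refine absurd (orth fun b hb h4 => ?_) (not_orth ?_)
          · rw [real_inner_comm]
            exact hP α hα b hb hPα (h3 b hb h4)
          · by_contra h4
            exact h3 α hα h4 hPα
        · right
          intro b hb h4
          rcases supp b hb h4 with rfl | h5
          exacts [hPα, h3 b hb h5]

/-- The Dynkin diagram is connected. -/
theorem base_connected (P : V → Prop) {a : V} (ha : a ∈ ctx.base) (hPa : P a)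
    (step : ∀ b ∈ ctx.base, ∀ b' ∈ ctx.base, P b → ⟪b, b'⟫ ≠ 0 → P b') :
    ∀ b ∈ ctx.base, P b := by
  have full : ∀ b ∈ ctx.base, ctx.coord b ctx.θ ≠ 0 := fun b hb => by
    have := ctx.coord_nonneg (ctx.theta_highest b (ctx.pos_subset (ctx.base_subset hb))) b
    rw [map_sub, ctx.coord_self hb] at this
    linarith
  obtain ⟨n, hn⟩ := exists_nat_gt (ctx.height ctx.θ)
  rcases ctx.support_dichotomy P (fun b hb b' hb' h h' => by
    by_contra h0
    exact h' (step b hb b' hb' h h0)) n ctx.θ ctx.theta_mem hn with h | h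
  · exact fun b hb => h b hb (full b hb)
  · exact absurd hPa (h a ha (full a ha))

/-! ### Highest roots of subsystems -/

section Highest

variable {ctx}
variable {S C : Finset V} {β γ : V}

theorem IsHighest.eq {β' : V} (h : ctx.IsHighest S β) (h' : ctx.IsHighest S β') : β = β' :=
  ctx.rootLE_antisymm (h'.2.2 β h.1) (h.2.2 β' h'.1)

theorem IsHighest.inner_nonneg (h : ctx.IsHighest S β) (hS : IsSubsystem S) (hγ : γ ∈ S)
    (hpos : γ ∈ ctx.Pos) : 0 ≤ ⟪γ, β⟫ := by
  by_contra! hneg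
  have hne : γ + β ≠ 0 := fun h0 => by
    have := congrArg ctx.height h0
    rw [map_add, map_zero] at this
    linarith [ctx.one_le_height hpos, ctx.one_le_height h.2.1]
  have h1 := h.2.2 _ (hS.add_mem hγ h.1 hneg hne)
  refine hS.ne_zero γ hγ (ctx.eq_of_coord_eq fun α => ?_)
  have h2 := ctx.coord_nonneg h1 α
  rw [map_sub, map_add] at h2
  rw [map_zero]
  linarith [ctx.pos_coord_nonneg hpos α]

/-- In the Heisenberg set of a highest root `β`, every root other than `β` pairs to `1` with the
coroot of `β`. -/
theorem IsHighest.cartanPairing_eq_one (h : ctx.IsHighest S β) (hS : IsSubsystem S) (hγ : γ ∈ S)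
    (hpos : 0 < ⟪γ, β⟫) (hne : γ ≠ β) : cartanPairing γ β = 1 := by
  obtain ⟨k, hk⟩ := hS.integral β h.1 γ hγ
  have hk0 : 0 < k := by
    have := (cartanPairing_pos_iff (hS.ne_zero β h.1)).2 hpos
    rw [hk] at this
    exact_mod_cast this
  by_contra h1
  have hk2 : 2 ≤ k := by
    have : k ≠ 1 := by
      rintro rfl
      exact h1 (by rw [hk]; norm_num)
    omega
  have hk2' : (2 : ℝ) ≤ k := by exact_mod_cast hk2
  have h2 := h.2.2 _ (hS.neg_mem (hS.reflect β h.1 γ hγ))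
  have h3 := h.2.2 γ hγ
  refine hne (ctx.eq_of_coord_eq fun α => ?_)
  have h4 := ctx.coord_nonneg h2 α
  have h5 := ctx.coord_nonneg h3 α
  have h6 := ctx.pos_coord_nonneg h.2.1 α
  rw [hk] at h4
  simp only [map_sub, map_neg, map_smul, smul_eq_mul] at h4 h5
  nlinarith

/-- Every irreducible component of a subsystem has a highest root. -/
theorem exists_isHighest (hS : IsSubsystem S) (hSΔ : S ⊆ ctx.Δ) (hC : IsComponent S C) :
    ∃ β, ctx.IsHighest C β := by
  have hCs := hS.component hC
  have hCΔ : C ⊆ ctx.Δ := hC.subset.trans hSΔ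
  let M : V → Prop := fun δ =>
    (δ ∈ C ∧ δ ∈ ctx.Pos) ∧ ∀ ε ∈ C, ε ∈ ctx.Pos → ctx.rootLE δ ε → ε = δ
  have above : ∀ γ ∈ C, γ ∈ ctx.Pos → ∃ δ, M δ ∧ ctx.rootLE γ δ := by
    intro γ hγ hpos
    obtain ⟨δ, hδ, hmax⟩ := Finset.exists_max_image
      (C.filter fun δ => δ ∈ ctx.Pos ∧ ctx.rootLE γ δ) ctx.height
      ⟨γ, Finset.mem_filter.2 ⟨hγ, hpos, by
        rw [rootLE, sub_self]
        exact AddSubmonoid.zero_mem _⟩⟩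
    obtain ⟨hδC, hδpos, hγδ⟩ := Finset.mem_filter.1 hδ
    refine ⟨δ, ⟨⟨hδC, hδpos⟩, fun ε hε hεpos hδε => ?_⟩, hγδ⟩
    have h1 := hmax ε (Finset.mem_filter.2 ⟨hε, hεpos, ctx.rootLE_trans hγδ hδε⟩)
    rcases ctx.height_pos hδε with h2 | h2
    · exact sub_eq_zero.1 h2
    · rw [map_sub] at h2
      linarith
  have dominant : ∀ δ, M δ → ∀ ε ∈ C, ε ∈ ctx.Pos → 0 ≤ ⟪δ, ε⟫ := by
    rintro δ ⟨⟨hδ, hδpos⟩, hmax⟩ ε hε hεpos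
    by_contra! hneg
    have hsum := ctx.add_pos_mem hδpos hεpos hneg
    have h1 := hmax (δ + ε) (hCs.add_mem hδ hε hneg (ctx.pos_ne_zero hsum)) hsum (by
      rw [rootLE, add_sub_cancel_left]
      exact ctx.pos_coords ε hεpos)
    exact ctx.pos_ne_zero hεpos (by simpa using h1)
  have unique : ∀ δ, M δ → ∀ ε, M ε → δ = ε := by
    intro δ hδ ε hε
    by_contra hne
    have hpos := dominant δ hδ ε hε.1.1 hε.1.2
    rcases hpos.lt_or_eq with hpos | hzero
    · have hsub := hCs.sub_mem hδ.1.1 hε.1.1 hpos hne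
      rcases ctx.pos_or_neg _ (hCΔ hsub) with h1 | h1
      · exact hne (hε.2 δ hδ.1.1 hδ.1.2 (ctx.pos_coords _ h1))
      · rw [neg_sub] at h1
        exact hne (hδ.2 ε hε.1.1 hε.1.2 (ctx.pos_coords _ h1)).symm
    · obtain ⟨g, hgS, h1, h2⟩ := hS.exists_common_neighbour (hC.subset hδ.1.1)
        (hC.reachable hδ.1.1 hε.1.1)
      have hgC := hC.mem_of_inner_ne hδ.1.1 hgS h1
      obtain ⟨g', hg'C, hg'pos, h1', h2'⟩ :
          ∃ g' ∈ C, g' ∈ ctx.Pos ∧ ⟪δ, g'⟫ ≠ 0 ∧ ⟪g', ε⟫ ≠ 0 := by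
        rcases ctx.pos_or_neg g (hCΔ hgC) with h | h
        · exact ⟨g, hgC, h, h1, h2⟩
        · exact ⟨-g, hCs.neg_mem hgC, h, by simpa using h1, by simpa using h2⟩
      have hδg : 0 < ⟪δ, g'⟫ := (dominant δ hδ g' hg'C hg'pos).lt_of_ne' h1'
      have hεg : 0 < ⟪ε, g'⟫ := (dominant ε hε g' hg'C hg'pos).lt_of_ne'
        (by rwa [real_inner_comm])
      obtain ⟨k, hk⟩ := hCs.integral δ hδ.1.1 g' hg'C
      have hk0 : (1 : ℝ) ≤ k := by
        have := (cartanPairing_pos_iff (γ := g') (ctx.pos_ne_zero hδ.1.2)).2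
          (by rwa [real_inner_comm])
        rw [hk] at this
        have : 0 < k := by exact_mod_cast this
        exact_mod_cast this
      have hr := hCs.reflect δ hδ.1.1 g' hg'C
      rw [hk] at hr
      rcases ctx.pos_or_neg _ (hCΔ hr) with h3 | h3
      · have hle : ∀ α, ctx.coord α δ ≤ ctx.coord α g' := by
          intro α
          have h4 := ctx.pos_coord_nonneg h3 α
          rw [map_sub, map_smul, smul_eq_mul] at h4
          nlinarith [ctx.pos_coord_nonneg hδ.1.2 α]
        have hsub : g' ≠ δ → g' - δ ∈ ctx.Pos := by
          intro hne'
          refine (ctx.pos_or_neg _ (hCΔ (hCs.sub_mem hg'C hδ.1.1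
            (by rwa [real_inner_comm]) hne'))).resolve_right fun h5 => hne' ?_
          refine ctx.eq_of_coord_eq fun α => ?_
          have h6 := ctx.pos_coord_nonneg h5 α
          rw [map_neg, map_sub] at h6
          linarith [hle α]
        by_cases hne' : g' = δ
        · rw [hne', real_inner_comm, ← hzero] at hεg
          exact lt_irrefl _ hεg
        · exact hne' (hδ.2 g' hg'C hg'pos (ctx.pos_coords _ (hsub hne')))
      · have h4 := dominant ε hε _ (hCs.neg_mem hr) h3
        rw [inner_neg_right, inner_sub_right, inner_smul_right, real_inner_comm δ ε,
          ← hzero] at h4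
        linarith
  obtain ⟨γ, hγ, rfl⟩ := hC
  set C := component S γ
  have hγC : γ ∈ C := mem_component_self hγ
  obtain ⟨γ', hγ'C, hγ'pos⟩ : ∃ γ' ∈ C, γ' ∈ ctx.Pos := by
    rcases ctx.pos_or_neg γ (hCΔ hγC) with h | h
    · exact ⟨γ, hγC, h⟩
    · exact ⟨-γ, hCs.neg_mem hγC, h⟩
  obtain ⟨β, hβ, -⟩ := above γ' hγ'C hγ'pos
  have hle : ∀ δ ∈ C, δ ∈ ctx.Pos → ctx.rootLE δ β := by
    intro δ hδ hδpos
    obtain ⟨ε, hε, hδε⟩ := above δ hδ hδpos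
    rwa [unique β hβ ε hε]
  refine ⟨β, hβ.1.1, hβ.1.2, fun δ hδ => ?_⟩
  rcases ctx.pos_or_neg δ (hCΔ hδ) with h | h
  · exact hle δ hδ h
  · have := AddSubmonoid.add_mem _ (ctx.pos_coords _ h) (ctx.pos_coords _ hβ.1.2)
    rwa [rootLE, show β - δ = -δ + β by abel]

/-! ### The Kostant cascade -/

theorem CascadeMem.isSubsystem_and_isHighest (h : ctx.CascadeMem S β) :
    IsSubsystem S ∧ S ⊆ ctx.Δ ∧ ctx.IsHighest S β := by
  induction h with
  | top =>
    exact ⟨ctx.isSubsystem_roots, subset_rfl, ctx.pos_subset ctx.theta_mem, ctx.theta_mem,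
      ctx.theta_highest⟩
  | step _ hC hβ' ih =>
    exact ⟨(ih.1.orthSub _).component hC,
      hC.subset.trans ((Finset.filter_subset _ _).trans ih.2.1), hβ'⟩

theorem CascadeMem.isSubsystem (h : ctx.CascadeMem S β) : IsSubsystem S :=
  h.isSubsystem_and_isHighest.1

theorem CascadeMem.subset (h : ctx.CascadeMem S β) : S ⊆ ctx.Δ :=
  h.isSubsystem_and_isHighest.2.1

theorem CascadeMem.isHighest (h : ctx.CascadeMem S β) : ctx.IsHighest S β :=
  h.isSubsystem_and_isHighest.2.2

variable (ctx) in
/-- One step of the cascade construction. -/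
def CascadeStep (p q : Finset V × V) : Prop :=
  IsComponent (orthSub p.1 p.2) q.1 ∧ ctx.IsHighest q.1 q.2

theorem CascadeMem.reachable (h : ctx.CascadeMem S β) :
    Relation.ReflTransGen ctx.CascadeStep (ctx.Δ, ctx.θ) (S, β) := by
  induction h with
  | top => exact .refl
  | step _ hC hβ' ih => exact ih.tail ⟨hC, hβ'⟩

theorem CascadeStep.subset {p q : Finset V × V} (h : ctx.CascadeStep p q) : q.1 ⊆ p.1 :=
  h.1.subset.trans (Finset.filter_subset _ _)

theorem subset_of_reachable {p q : Finset V × V}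
    (h : Relation.ReflTransGen ctx.CascadeStep p q) : q.1 ⊆ p.1 := by
  induction h with
  | refl => exact subset_rfl
  | tail _ h ih => exact h.subset.trans ih

theorem mem_of_reachable {p q : Finset V × V} (hp : p.2 ∈ p.1)
    (h : Relation.ReflTransGen ctx.CascadeStep p q) : q.2 ∈ q.1 := by
  rcases h.cases_tail with h | ⟨_, _, h⟩
  · exact h ▸ hp
  · exact h.2.1

theorem orthogonal_of_reachable (n : ℕ) : ∀ p q q' : Finset V × V, p.1.card ≤ n →
    IsSubsystem p.1 → p.2 ∈ p.1 → Relation.ReflTransGen ctx.CascadeStep p q →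
    Relation.ReflTransGen ctx.CascadeStep p q' → q = q' ∨ ⟪q.2, q'.2⟫ = 0 := by
  induction n with
  | zero =>
    intro p q q' hcard _ hp
    rw [Nat.le_zero, Finset.card_eq_zero] at hcard
    rw [hcard] at hp
    simp at hp
  | succ n ih =>
    intro p q q' hcard hps hp h h'
    have orth : ∀ {q r : Finset V × V}, ctx.CascadeStep p r →
        Relation.ReflTransGen ctx.CascadeStep r q → ⟪q.2, p.2⟫ = 0 := fun hr hq =>
      (mem_orthSub.1 (hr.1.subset (subset_of_reachable hq (mem_of_reachable hr.2.1 hq)))).2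
    rcases h.cases_head with rfl | ⟨r, hr, hq⟩
    · rcases h'.cases_head with rfl | ⟨r', hr', hq'⟩
      · exact Or.inl rfl
      · right
        rw [real_inner_comm]
        exact orth hr' hq'
    · rcases h'.cases_head with rfl | ⟨r', hr', hq'⟩
      · exact Or.inr (orth hr hq)
      · rcases hr.1.eq_or_orthogonal hr'.1 with he | he
        · have hrr : r = r' := Prod.ext he (hr.2.eq (he ▸ hr'.2))
          subst hrr
          refine ih r q q' ?_ ((hps.orthSub _).component hr.1) hr.2.1 hq hq'
          have hlt : r.1.card < p.1.card := by
            refine Finset.card_lt_card ⟨hr.subset, fun hsub => ?_⟩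
            exact hps.ne_zero _ hp (inner_self_eq_zero.1
              (mem_orthSub.1 (hr.1.subset (hsub hp))).2)
          omega
        · exact Or.inr (he _ (subset_of_reachable hq (mem_of_reachable hr.2.1 hq)) _
            (subset_of_reachable hq' (mem_of_reachable hr'.2.1 hq')))

/-- The elements of the cascade are pairwise orthogonal. -/
theorem CascadeMem.orthogonal {S' : Finset V} {β' : V} (h : ctx.CascadeMem S β)
    (h' : ctx.CascadeMem S' β') (hne : β ≠ β') : ⟪β, β'⟫ = 0 := by
  have hΔ := (CascadeMem.top (ctx := ctx)).isHighest.1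
  rcases orthogonal_of_reachable _ _ _ _ le_rfl ctx.isSubsystem_roots hΔ h.reachable
    h'.reachable with h | h
  · exact absurd (congrArg Prod.snd h) hne
  · exact h

/-- Every positive root lies in the Heisenberg set of some cascade element. -/
theorem CascadeMem.exists_heisenberg (n : ℕ) : ∀ (S : Finset V) (β : V), S.card ≤ n →
    ctx.CascadeMem S β → ∀ γ ∈ S, γ ∈ ctx.Pos →
    ∃ S' β', ctx.CascadeMem S' β' ∧ γ ∈ S' ∧ 0 < ⟪γ, β'⟫ := by
  induction n with
  | zero =>
    intro S β hcard _ γ hγ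
    rw [Nat.le_zero, Finset.card_eq_zero] at hcard
    rw [hcard] at hγ
    simp at hγ
  | succ n ih =>
    intro S β hcard h γ hγ hpos
    rcases (h.isHighest.inner_nonneg h.isSubsystem hγ hpos).lt_or_eq with h1 | h1
    · exact ⟨S, β, h, hγ, h1⟩
    · have hγo : γ ∈ orthSub S β := mem_orthSub.2 ⟨hγ, h1.symm⟩
      have hC := isComponent_component hγo
      obtain ⟨β', hβ'⟩ := exists_isHighest (ctx := ctx) (h.isSubsystem.orthSub β)
        ((Finset.filter_subset _ _).trans h.subset) hC
      refine ih _ β' ?_ (h.step hC hβ') γ (mem_component_self hγo) hpos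
      have hlt : (component (orthSub S β) γ).card < S.card := by
        refine Finset.card_lt_card
          ⟨hC.subset.trans (Finset.filter_subset _ _), fun hsub => ?_⟩
        exact h.isSubsystem.ne_zero β h.isHighest.1 (inner_self_eq_zero.1
          (mem_orthSub.1 (hC.subset (hsub h.isHighest.1))).2)
      omega

/-- A cascade element lies in a given cascade subsystem or is orthogonal to it. -/
theorem CascadeMem.mem_or_orthogonal {S' : Finset V} {β' : V} (h : ctx.CascadeMem S β)
    (h' : ctx.CascadeMem S' β') : β' ∈ S ∨ ∀ γ ∈ S, ⟪γ, β'⟫ = 0 := by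
  induction h with
  | top => exact Or.inl (h'.subset h'.isHighest.1)
  | @step S C β ε hS hC hε ih =>
    have hsub : C ⊆ S := hC.subset.trans (Finset.filter_subset _ _)
    rcases ih with h1 | h1
    · by_cases hne : β' = β
      · subst hne
        exact Or.inr fun γ hγ => (mem_orthSub.1 (hC.subset hγ)).2
      · by_contra! hcon
        obtain ⟨h2, γ, hγ, h3⟩ := hcon
        exact h2 (hC.mem_of_inner_ne hγ (mem_orthSub.2 ⟨h1, h'.orthogonal hS hne⟩) h3)
    · exact Or.inr fun γ hγ => h1 γ (hsub hγ)

/-- A simple root in the Heisenberg set of `β` makes no acute angle with any other cascade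
element. -/
theorem CascadeMem.inner_simple_nonpos {S' : Finset V} {β' α : V} (h : ctx.CascadeMem S β)
    (h' : ctx.CascadeMem S' β') (hne : β' ≠ β) (hα : α ∈ ctx.base) (hαS : α ∈ S)
    (hpos : 0 < ⟪α, β⟫) : ⟪α, β'⟫ ≤ 0 := by
  by_contra! h1
  have hβ'S : β' ∈ S := (h.mem_or_orthogonal h').resolve_right fun h2 => h1.ne' (h2 α hαS)
  have horth := h'.orthogonal h hne
  have hne' : β' ≠ α := by
    rintro rfl
    exact hpos.ne' horth
  have hsub := h.isSubsystem.sub_mem hβ'S hαS (by rwa [real_inner_comm]) hne'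
  have h2 := h.isHighest.inner_nonneg h.isSubsystem hsub
    (ctx.sub_simple_pos h'.isHighest.2.1 hα (h.subset hsub))
  rw [inner_sub_left, horth] at h2
  linarith

end Highest

/-! ### Values of roots on the cascade element -/

theorem inner_cascElt (K : Finset V) (γ : V) :
    2 * ⟪γ, cascElt K⟫ = ∑ β ∈ K, cartanPairing γ β := by
  unfold cascElt cartanPairing
  rw [inner_sum, Finset.mul_sum]
  refine Finset.sum_congr rfl fun β _ => ?_
  rw [inner_smul_right, div_eq_mul_inv]
  ring

section Values

variable {ctx}
variable {K : Finset V} {β γ : V}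

theorem IsCascade.pos_mem (hK : ctx.IsCascade K) (hβ : β ∈ K) : β ∈ ctx.Pos := by
  obtain ⟨S, hS⟩ := (hK β).1 hβ
  exact hS.isHighest.2.1

theorem IsCascade.orthogonal (hK : ctx.IsCascade K) {β' : V} (hβ : β ∈ K) (hβ' : β' ∈ K)
    (hne : β ≠ β') : ⟪β, β'⟫ = 0 := by
  obtain ⟨S, hS⟩ := (hK β).1 hβ
  obtain ⟨S', hS'⟩ := (hK β').1 hβ'
  exact hS.orthogonal hS' hne

theorem IsCascade.exists_heisenberg (hK : ctx.IsCascade K) (hγ : γ ∈ ctx.Pos) :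
    ∃ S, ∃ β ∈ K, ctx.CascadeMem S β ∧ γ ∈ S ∧ 0 < ⟪γ, β⟫ := by
  obtain ⟨S, β, h, h'⟩ := CascadeMem.exists_heisenberg _ _ _ le_rfl
    (CascadeMem.top (ctx := ctx)) γ (ctx.pos_subset hγ) hγ
  exact ⟨S, β, (hK β).2 ⟨S, h⟩, h, h'⟩

theorem IsCascade.value_eq_one (hK : ctx.IsCascade K) (hβ : β ∈ K) : ⟪β, cascElt K⟫ = 1 := by
  have h := inner_cascElt K β
  rw [Finset.sum_eq_single_of_mem β hβ, cartanPairing_self (ctx.pos_ne_zero (hK.pos_mem hβ))] at h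
  · linarith
  · intro β' hβ' hne
    rw [cartanPairing_eq_zero_iff (ctx.pos_ne_zero (hK.pos_mem hβ'))]
    exact hK.orthogonal hβ hβ' hne.symm

theorem IsCascade.inner_self_sub_sum (hK : ctx.IsCascade K) (hγ : γ ∈ ctx.Pos) :
    ⟪(2 : ℝ) • γ - ∑ β ∈ K, cartanPairing γ β • β,
      (2 : ℝ) • γ - ∑ β ∈ K, cartanPairing γ β • β⟫ =
    ⟪γ, γ⟫ * (4 - ∑ β ∈ K, cartanPairing γ β * cartanPairing β γ) := by
  have hγ0 := ctx.pos_ne_zero hγ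
  have h1 : ⟪γ, ∑ β ∈ K, cartanPairing γ β • β⟫ = ∑ β ∈ K, cartanPairing γ β * ⟪γ, β⟫ := by
    rw [inner_sum]
    simp [inner_smul_right]
  have h2 : ⟪∑ β ∈ K, cartanPairing γ β • β, ∑ β ∈ K, cartanPairing γ β • β⟫ =
      2 * ∑ β ∈ K, cartanPairing γ β * ⟪γ, β⟫ := by
    rw [sum_inner, Finset.mul_sum]
    refine Finset.sum_congr rfl fun β hβ => ?_
    rw [inner_sum, Finset.sum_eq_single_of_mem β hβ]
    · rw [inner_smul_left, inner_smul_right,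
        cartanPairing_mul_inner_self γ (ctx.pos_ne_zero (hK.pos_mem hβ))]
      simp only [conj_trivial]
      ring
    · intro β' hβ' hne
      rw [inner_smul_left, inner_smul_right, hK.orthogonal hβ hβ' hne.symm]
      simp
  have h3 : ⟪γ, γ⟫ * ∑ β ∈ K, cartanPairing γ β * cartanPairing β γ =
      2 * ∑ β ∈ K, cartanPairing γ β * ⟪γ, β⟫ := by
    rw [Finset.mul_sum, Finset.mul_sum]
    refine Finset.sum_congr rfl fun β _ => ?_
    have := cartanPairing_mul_inner_self β hγ0
    rw [real_inner_comm γ β] at this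
    linear_combination cartanPairing γ β * this
  rw [inner_sub_left, inner_sub_right, inner_sub_right, h2,
    real_inner_comm ((2 : ℝ) • γ) (∑ β ∈ K, cartanPairing γ β • β),
    inner_smul_left, inner_smul_left, inner_smul_right, h1, mul_sub, h3]
  simp only [conj_trivial]
  ring

theorem IsCascade.sum_mul_le (hK : ctx.IsCascade K) (hγ : γ ∈ ctx.Pos) :
    ∑ β ∈ K, cartanPairing γ β * cartanPairing β γ ≤ 4 := by
  have h1 := hK.inner_self_sub_sum hγ
  have h2 : (0 : ℝ) ≤ ⟪γ, γ⟫ * (4 - ∑ β ∈ K, cartanPairing γ β * cartanPairing β γ) :=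
    h1 ▸ real_inner_self_nonneg
  linarith [nonneg_of_mul_nonneg_right h2 (inner_self_pos_of_ne (ctx.pos_ne_zero hγ))]

variable (ctx) in
theorem abs_cartanPairing_le (hβ : β ∈ ctx.Δ) (hγ : γ ∈ ctx.Δ) :
    |cartanPairing γ β| ≤ cartanPairing γ β * cartanPairing β γ := by
  have hβ0 := ctx.isSubsystem_roots.ne_zero β hβ
  have hγ0 := ctx.isSubsystem_roots.ne_zero γ hγ
  obtain ⟨k, hk⟩ := ctx.pairing_int β hβ γ hγ
  obtain ⟨l, hl⟩ := ctx.pairing_int γ hγ β hβ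
  have h1 := cartanPairing_mul_inner_self γ hβ0
  have h2 := cartanPairing_mul_inner_self β hγ0
  have h3 := inner_self_pos_of_ne hβ0
  have h4 := inner_self_pos_of_ne hγ0
  rw [real_inner_comm γ β] at h2
  rw [hk] at h1 ⊢
  rw [hl] at h2 ⊢
  have hkl : (k : ℝ) * ⟪β, β⟫ = l * ⟪γ, γ⟫ := h1.trans h2.symm
  suffices |k| ≤ k * l by exact_mod_cast this
  rcases lt_trichotomy k 0 with h | h | h
  · have hl0 : l < 0 := by
      have hk' : (k : ℝ) < 0 := by exact_mod_cast h
      by_contra! hl0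
      have hl' : (0 : ℝ) ≤ l := by exact_mod_cast hl0
      nlinarith [mul_nonneg hl' h4.le, mul_pos (neg_pos.2 hk') h3]
    rw [abs_of_neg h]
    nlinarith
  · simp [h]
  · have hl0 : 0 < l := by
      have hk' : (0 : ℝ) < k := by exact_mod_cast h
      by_contra! hl0
      have hl' : (l : ℝ) ≤ 0 := by exact_mod_cast hl0
      nlinarith [mul_nonneg (neg_nonneg.2 hl') h4.le, mul_pos hk' h3]
    rw [abs_of_pos h]
    nlinarith

theorem IsCascade.sum_abs_le (hK : ctx.IsCascade K) (hγ : γ ∈ ctx.Pos) :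
    ∑ β ∈ K, |cartanPairing γ β| ≤ 4 :=
  (Finset.sum_le_sum fun _ hβ => ctx.abs_cartanPairing_le (ctx.pos_subset (hK.pos_mem hβ))
    (ctx.pos_subset hγ)).trans (hK.sum_mul_le hγ)

/-- In the extremal case a positive root is in the span of the cascade. -/
theorem IsCascade.two_smul_eq_sum (hK : ctx.IsCascade K) (hγ : γ ∈ ctx.Pos)
    (h : 4 ≤ ∑ β ∈ K, |cartanPairing γ β|) :
    (2 : ℝ) • γ = ∑ β ∈ K, cartanPairing γ β • β ∧
      ∀ β ∈ K, |cartanPairing γ β| = cartanPairing γ β * cartanPairing β γ := by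
  have hle : ∀ β ∈ K, |cartanPairing γ β| ≤ cartanPairing γ β * cartanPairing β γ :=
    fun β hβ => ctx.abs_cartanPairing_le (ctx.pos_subset (hK.pos_mem hβ)) (ctx.pos_subset hγ)
  have h1 := hK.sum_mul_le hγ
  have h2 := Finset.sum_le_sum hle
  refine ⟨?_, (Finset.sum_eq_sum_iff_of_le hle).1 (by linarith)⟩
  have h3 := hK.inner_self_sub_sum hγ
  rw [show ∑ β ∈ K, cartanPairing γ β * cartanPairing β γ = 4 by linarith, sub_self,
    mul_zero] at h3
  exact sub_eq_zero.1 (inner_self_eq_zero.1 h3)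

/-- Twice the value of a positive root on the cascade element is an integer in `[-2, 4]`. -/
theorem IsCascade.exists_two_mul_value_eq (hK : ctx.IsCascade K) (hγ : γ ∈ ctx.Pos) :
    ∃ k : ℤ, 2 * ⟪γ, cascElt K⟫ = k ∧ -2 ≤ k ∧ k ≤ 4 := by
  have hsum : ∃ k : ℤ, ∑ β ∈ K, cartanPairing γ β = k := by
    choose! f hf using fun β (hβ : β ∈ K) =>
      ctx.pairing_int β (ctx.pos_subset (hK.pos_mem hβ)) γ (ctx.pos_subset hγ)
    refine ⟨∑ β ∈ K, f β, ?_⟩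
    rw [Finset.sum_congr rfl hf]
    push_cast
    rfl
  obtain ⟨k, hk⟩ := hsum
  obtain ⟨S, β, hβ, hS, hγS, hpos⟩ := hK.exists_heisenberg hγ
  have h1 := hK.sum_abs_le hγ
  have hle : 1 ≤ cartanPairing γ β := by
    by_cases hne : γ = β
    · rw [hne, cartanPairing_self (ctx.pos_ne_zero (hK.pos_mem hβ))]
      norm_num
    · exact (hS.isHighest.cartanPairing_eq_one hS.isSubsystem hγS hpos hne).ge
  have h2 : |cartanPairing γ β| + cartanPairing γ β ≤
      ∑ β ∈ K, (|cartanPairing γ β| + cartanPairing γ β) :=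
    Finset.single_le_sum (f := fun β => |cartanPairing γ β| + cartanPairing γ β)
      (fun β _ => by linarith [neg_abs_le (cartanPairing γ β)]) hβ
  have h3 : ∑ β ∈ K, cartanPairing γ β ≤ ∑ β ∈ K, |cartanPairing γ β| :=
    Finset.sum_le_sum fun β _ => le_abs_self _
  rw [Finset.sum_add_distrib, abs_of_nonneg (by linarith), hk] at h2
  rw [hk] at h3
  refine ⟨k, by rw [inner_cascElt, hk], ?_, ?_⟩
  · have : (-2 : ℝ) ≤ k := by linarith
    exact_mod_cast this
  · have : (k : ℝ) ≤ 4 := by linarith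
    exact_mod_cast this

/-- A simple root of value `-1` and a simple root of value `0` are not adjacent. -/
theorem IsCascade.not_adjacent (hK : ctx.IsCascade K) {α : V} (hα : α ∈ ctx.base)
    (hγ : γ ∈ ctx.base) (hα1 : ⟪α, cascElt K⟫ = -1) (hγ0 : ⟪γ, cascElt K⟫ = 0) :
    ⟪α, γ⟫ = 0 := by
  by_contra hadj
  have hαP := ctx.base_subset hα
  have hγP := ctx.base_subset hγ
  have hα0 := ctx.pos_ne_zero hαP
  have hβ0 : ∀ β ∈ K, β ≠ 0 := fun β hβ => ctx.pos_ne_zero (hK.pos_mem hβ)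
  have hne : α ≠ γ := by
    rintro rfl
    rw [hα1] at hγ0
    norm_num at hγ0
  have hneg : ⟪α, γ⟫ < 0 := (ctx.inner_simple_nonpos hα hγ hne).lt_of_ne hadj
  obtain ⟨z, hz⟩ := ctx.pairing_int α (ctx.pos_subset hαP) γ (ctx.pos_subset hγP)
  have hz1 : cartanPairing γ α ≤ -1 := by
    have h1 := cartanPairing_mul_inner_self γ hα0
    rw [real_inner_comm α γ, hz] at h1
    have h2 : (z : ℝ) < 0 := by
      by_contra! h2
      nlinarith [mul_nonneg h2 (inner_self_pos_of_ne hα0).le]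
    have h3 : z ≤ -1 := by
      have : z < 0 := by exact_mod_cast h2
      omega
    rw [hz]
    exact_mod_cast h3
  obtain ⟨S, ι, hι, hS, hαS, hαι⟩ := hK.exists_heisenberg hαP
  obtain ⟨T, κ, hκ, hT, hγT, hγκ⟩ := hK.exists_heisenberg hγP
  have hαι1 : cartanPairing α ι = 1 := by
    refine hS.isHighest.cartanPairing_eq_one hS.isSubsystem hαS hαι ?_
    rintro rfl
    rw [hK.value_eq_one hι] at hα1
    norm_num at hα1
  have hγκ1 : cartanPairing γ κ = 1 := by
    refine hT.isHighest.cartanPairing_eq_one hT.isSubsystem hγT hγκ ?_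
    rintro rfl
    rw [hK.value_eq_one hκ] at hγ0
    norm_num at hγ0
  have hsumα := inner_cascElt K α
  have hsumγ := inner_cascElt K γ
  rw [hα1] at hsumα
  rw [hγ0] at hsumγ
  have habs : 4 ≤ ∑ β ∈ K, |cartanPairing α β| := by
    have h2 : |cartanPairing α ι| + cartanPairing α ι ≤
        ∑ β ∈ K, (|cartanPairing α β| + cartanPairing α β) :=
      Finset.single_le_sum (f := fun β => |cartanPairing α β| + cartanPairing α β)
        (fun β _ => by linarith [neg_abs_le (cartanPairing α β)]) hι
    rw [Finset.sum_add_distrib, ← hsumα, hαι1, abs_one] at h2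
    linarith
  obtain ⟨hspan, heq⟩ := hK.two_smul_eq_sum hαP habs
  have hαβ : ∀ β ∈ K, cartanPairing α β * ⟪β, β⟫ = cartanPairing β α * ⟪α, α⟫ := by
    intro β hβ
    rw [cartanPairing_mul_inner_self α (hβ0 β hβ), cartanPairing_mul_inner_self β hα0,
      real_inner_comm]
  have hkey : 2 * cartanPairing γ α = ∑ β ∈ K, cartanPairing γ β * cartanPairing β α := by
    have h1 := congrArg (fun v => ⟪γ, v⟫) hspan
    simp only [inner_smul_right, inner_sum] at h1
    have h2 := (inner_self_pos_of_ne hα0).ne'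
    apply mul_right_cancel₀ h2
    rw [Finset.sum_mul, mul_assoc, cartanPairing_mul_inner_self γ hα0, h1, Finset.mul_sum]
    refine Finset.sum_congr rfl fun β hβ => ?_
    linear_combination cartanPairing γ β * hαβ β hβ -
      cartanPairing α β * cartanPairing_mul_inner_self γ (hβ0 β hβ)
  have hn_abs : ∀ β ∈ K, |cartanPairing β α| ≤ 1 := by
    intro β hβ
    by_cases h0 : cartanPairing α β = 0
    · have : cartanPairing β α = 0 := by
        rw [cartanPairing_eq_zero_iff hα0, real_inner_comm,
          ← cartanPairing_eq_zero_iff (hβ0 β hβ)]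
        exact h0
      rw [this, abs_zero]
      exact zero_le_one
    · have h1 := congrArg abs (heq β hβ)
      rw [abs_abs, abs_mul] at h1
      have h2 : 0 < |cartanPairing α β| := abs_pos.2 h0
      nlinarith
  have hn : ∀ β ∈ K, β ≠ ι → cartanPairing β α ≤ 0 := by
    intro β hβ hβι
    obtain ⟨U, hU⟩ := (hK β).1 hβ
    have h1 := hS.inner_simple_nonpos hU hβι hα hαS hαι
    by_contra! h2
    rw [cartanPairing_pos_iff hα0, real_inner_comm] at h2
    linarith
  have hm : ∀ β ∈ K, β ≠ κ → cartanPairing γ β ≤ 0 := by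
    intro β hβ hβκ
    obtain ⟨U, hU⟩ := (hK β).1 hβ
    have h1 := hT.inner_simple_nonpos hU hβκ hγ hγT hγκ
    by_contra! h2
    rw [cartanPairing_pos_iff (hβ0 β hβ)] at h2
    linarith
  rw [← Finset.add_sum_erase K _ hκ, hγκ1] at hsumγ hkey
  rw [one_mul] at hkey
  have hnκ := (abs_le.1 (hn_abs κ hκ)).1
  by_cases hcase : ι = κ ∨ cartanPairing γ ι = 0
  · have : 0 ≤ ∑ β ∈ K.erase κ, cartanPairing γ β * cartanPairing β α := by
      refine Finset.sum_nonneg fun β hβ => ?_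
      obtain ⟨hβκ, hβ⟩ := Finset.mem_erase.1 hβ
      by_cases hβι : β = ι
      · rw [hβι, hcase.resolve_left fun h => hβκ (hβι.trans h), zero_mul]
      · exact mul_nonneg_of_nonpos_of_nonpos (hm β hβ hβκ) (hn β hβ hβι)
    linarith
  · push Not at hcase
    have hιT : ι ∈ T := (hT.mem_or_orthogonal hS).resolve_right fun h =>
      hcase.2 ((cartanPairing_eq_zero_iff (hβ0 ι hι)).2 (h γ hγT))
    have hακ : ⟪α, κ⟫ = 0 := by
      rcases hS.mem_or_orthogonal hT with h | h
      · exact absurd (ctx.rootLE_antisymm (hT.isHighest.2.2 ι hιT) (hS.isHighest.2.2 κ h)) hcase.1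
      · exact h α hαS
    have hκα : cartanPairing κ α = 0 := by
      rw [cartanPairing_eq_zero_iff hα0, real_inner_comm]
      exact hακ
    have : ∑ β ∈ K.erase κ, cartanPairing γ β ≤
        ∑ β ∈ K.erase κ, cartanPairing γ β * cartanPairing β α := by
      refine Finset.sum_le_sum fun β hβ => ?_
      obtain ⟨hβκ, hβ⟩ := Finset.mem_erase.1 hβ
      nlinarith [hm β hβ hβκ, (abs_le.1 (hn_abs β hβ)).2]
    linarith

end Values

theorem IsCascade.value_ne_two {ctx : RootSystemCtx V} {K : Finset V} {γ : V}
    (hK : ctx.IsCascade K) (hγ : γ ∈ ctx.Pos)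
    (hsupp : ∀ α ∈ ctx.base, ctx.coord α γ ≠ 0 → 0 ≤ ⟪α, cascElt K⟫) : ⟪γ, cascElt K⟫ ≠ 2 := by
  intro h2
  have hsum := inner_cascElt K γ
  rw [h2] at hsum
  have hle : ∑ β ∈ K, cartanPairing γ β ≤ ∑ β ∈ K, |cartanPairing γ β| :=
    Finset.sum_le_sum fun _ _ => le_abs_self _
  have habs := hK.sum_abs_le hγ
  have hspan := (hK.two_smul_eq_sum hγ (by linarith)).1
  have heq := (Finset.sum_eq_sum_iff_of_le fun β (_ : β ∈ K) =>
    le_abs_self (cartanPairing γ β)).1 (by linarith)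
  have hnonneg : ∀ β ∈ K, 0 ≤ cartanPairing γ β := fun β hβ => heq β hβ ▸ abs_nonneg _
  obtain ⟨S, β, hβ, hS, hγS, hpos⟩ := hK.exists_heisenberg hγ
  have hne : γ ≠ β := by
    rintro rfl
    rw [hK.value_eq_one hβ] at h2
    norm_num at h2
  have hm := hS.isHighest.cartanPairing_eq_one hS.isSubsystem hγS hpos hne
  have hcoord : ∀ α, ctx.coord α β ≤ 2 * ctx.coord α γ := by
    intro α
    have h1 := congrArg (ctx.coord α) hspan
    simp only [map_smul, map_sum, smul_eq_mul] at h1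
    rw [h1]
    have h3 := Finset.single_le_sum (f := fun β => cartanPairing γ β * ctx.coord α β)
      (fun β hβ => mul_nonneg (hnonneg β hβ) (ctx.pos_coord_nonneg (hK.pos_mem hβ) α)) hβ
    simpa [hm] using h3
  have hdiff : 0 ≤ ⟪β - γ, cascElt K⟫ := by
    rw [ctx.inner_eq_sum_coord]
    refine Finset.sum_nonneg fun α hα => ?_
    by_cases h0 : ctx.coord α γ = 0
    · have h1 := hcoord α
      have h3 := ctx.pos_coord_nonneg (hK.pos_mem hβ) α
      rw [map_sub, show ctx.coord α β = 0 by linarith, h0]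
      simp
    · exact mul_nonneg (ctx.coord_nonneg (hS.isHighest.2.2 γ hγS) α) (hsupp α hα h0)
  rw [inner_sub_left, hK.value_eq_one hβ, h2] at hdiff
  norm_num at hdiff

/-! ### The element of the Weyl group inverting the cascade -/

theorem map_mem_of_mem_weylGroup {w : V ≃ₗ[ℝ] V} (hw : w ∈ ctx.weylGroup) :
    ∀ γ, w γ ∈ ctx.Δ ↔ γ ∈ ctx.Δ := by
  unfold weylGroup at hw
  induction hw using Subgroup.closure_induction with
  | mem s hs =>
    obtain ⟨α, hα, hs⟩ := hs
    have hαΔ := ctx.pos_subset (ctx.base_subset hα)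
    have hαα := (inner_self_pos_of_ne (ctx.pos_ne_zero (ctx.base_subset hα))).ne'
    have hmap : ∀ γ ∈ ctx.Δ, s γ ∈ ctx.Δ := fun γ hγ => hs γ ▸ ctx.reflect_mem α hαΔ γ hγ
    have hinv : ∀ γ, s (s γ) = γ := by
      intro γ
      have h1 : ⟪s γ, α⟫ = -⟪γ, α⟫ := by
        rw [hs γ, inner_sub_left, inner_smul_left]
        simp only [conj_trivial]
        field_simp
        ring
      rw [hs (s γ), h1, hs γ, mul_neg, neg_div, neg_smul]
      abel
    exact fun γ => ⟨fun h => hinv γ ▸ hmap _ h, hmap γ⟩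
  | one => exact fun _ => Iff.rfl
  | mul a b _ _ ha hb => exact fun γ => (ha (b γ)).trans (hb γ)
  | inv a _ ha =>
    intro γ
    rw [← ha (a⁻¹ γ)]
    exact iff_of_eq (congrArg (· ∈ ctx.Δ) (a.apply_symm_apply γ))

/-- `w` permutes the roots, and inverts exactly the positive roots of value `1` or `2` on the
cascade element of `K`. -/
structure InvertsCascade (K : Finset V) (w : V ≃ₗ[ℝ] V) : Prop where
  isCascade : ctx.IsCascade K
  map_mem : ∀ γ, w γ ∈ ctx.Δ ↔ γ ∈ ctx.Δ
  inversion : ∀ γ ∈ ctx.Pos,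
    (-(w γ) ∈ ctx.Pos ↔ (⟪γ, cascElt K⟫ = 1 ∨ ⟪γ, cascElt K⟫ = 2))

namespace InvertsCascade

variable {ctx}
variable {K : Finset V} {w : V ≃ₗ[ℝ] V} {γ : V}

theorem map_pos (h : ctx.InvertsCascade K w) (hγ : γ ∈ ctx.Pos) (h1 : ⟪γ, cascElt K⟫ ≠ 1)
    (h2 : ⟪γ, cascElt K⟫ ≠ 2) : w γ ∈ ctx.Pos :=
  (ctx.pos_or_neg _ ((h.map_mem γ).2 (ctx.pos_subset hγ))).resolve_right fun h3 =>
    ((h.inversion γ hγ).1 h3).elim h1 h2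

theorem value_cases (h : ctx.InvertsCascade K w) (hγ : γ ∈ ctx.Pos) :
    ⟪γ, cascElt K⟫ = -1 ∨ ⟪γ, cascElt K⟫ = 0 ∨ ⟪γ, cascElt K⟫ = 1 ∨ ⟪γ, cascElt K⟫ = 2 := by
  obtain ⟨k, hk, hk1, hk2⟩ := h.isCascade.exists_two_mul_value_eq hγ
  rcases Int.even_or_odd k with ⟨j, hj⟩ | hodd
  · have hv : ⟪γ, cascElt K⟫ = j := by
      rw [hj] at hk
      push_cast at hk
      linarith
    have hj1 : -1 ≤ j := by omega
    have hj2 : j ≤ 2 := by omega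
    rw [hv]
    interval_cases j <;> simp
  · have hv : ∀ i : ℤ, ⟪γ, cascElt K⟫ ≠ i := by
      intro i hi
      rw [hi] at hk
      have : 2 * i = k := by exact_mod_cast hk
      obtain ⟨j, hj⟩ := hodd
      omega
    obtain ⟨S, β, hβ, hS, hγS, hpos⟩ := h.isCascade.exists_heisenberg hγ
    have hβ1 := h.isCascade.value_eq_one hβ
    have hβP := h.isCascade.pos_mem hβ
    have hne : β ≠ γ := by
      rintro rfl
      exact hv 1 (by rw [hβ1, Int.cast_one])
    have hδΔ : β - γ ∈ ctx.Δ := hS.subset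
      (hS.isSubsystem.sub_mem hS.isHighest.1 hγS (real_inner_comm β γ ▸ hpos) hne)
    have hδ : β - γ ∈ ctx.Pos := by
      refine ctx.pos_of_height_pos hδΔ ?_
      rcases ctx.height_pos (hS.isHighest.2.2 γ hγS) with h0 | h0
      · exact absurd (sub_eq_zero.1 h0) hne
      · linarith
    have hδv : ⟪β - γ, cascElt K⟫ = 1 - ⟪γ, cascElt K⟫ := by rw [inner_sub_left, hβ1]
    have h1 := ctx.one_le_height (h.map_pos hγ (by exact_mod_cast hv 1) (by exact_mod_cast hv 2))
    have h2 := ctx.one_le_height (h.map_pos hδ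
      (fun h3 => hv 0 (by push_cast; linarith)) (fun h3 => hv (-1) (by push_cast; linarith)))
    have h3 := ctx.one_le_height ((h.inversion β hβP).2 (Or.inl hβ1))
    rw [map_sub, map_sub] at h2
    rw [map_neg] at h3
    linarith

theorem simple_value_cases (h : ctx.InvertsCascade K w) {α : V} (hα : α ∈ ctx.base) :
    ⟪α, cascElt K⟫ = -1 ∨ ⟪α, cascElt K⟫ = 0 ∨ ⟪α, cascElt K⟫ = 1 := by
  have hαP := ctx.base_subset hα
  rcases h.value_cases hαP with h1 | h1 | h1 | h1
  · exact .inl h1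
  · exact .inr (.inl h1)
  · exact .inr (.inr h1)
  · refine absurd h1 (h.isCascade.value_ne_two hαP fun s hs hne => ?_)
    have : s = α := by
      by_contra h2
      exact hne (ctx.coord_of_ne hs hα h2)
    rw [this, h1]
    norm_num

theorem cases_of_map_pos (h : ctx.InvertsCascade K w) {μ : V} (hμ : μ ∈ ctx.Δ)
    (hw : w μ ∈ ctx.Pos) :
    (μ ∈ ctx.Pos ∧ (⟪μ, cascElt K⟫ = -1 ∨ ⟪μ, cascElt K⟫ = 0)) ∨
      ⟪μ, cascElt K⟫ = -1 ∨ ⟪μ, cascElt K⟫ = -2 := by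
  rcases ctx.pos_or_neg μ hμ with h1 | h1
  · have h2 := mt (h.inversion μ h1).2 (ctx.pos_not_neg _ hw)
    rcases h.value_cases h1 with h3 | h3 | h3 | h3
    · exact .inl ⟨h1, .inl h3⟩
    · exact .inl ⟨h1, .inr h3⟩
    · exact absurd (.inl h3) h2
    · exact absurd (.inr h3) h2
  · have h2 := (h.inversion (-μ) h1).1 (by rwa [map_neg, neg_neg])
    rw [inner_neg_left] at h2
    right
    exact h2.imp (fun h3 => by linarith) (fun h3 => by linarith)

theorem height_map_eq_one (h : ctx.InvertsCascade K w) {δ : V}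
    (hw : w δ ∈ ctx.Pos)
    (hind : ∀ μ ∈ ctx.Δ, ∀ ν ∈ ctx.Δ, δ = μ + ν → w μ ∈ ctx.Pos → w ν ∈ ctx.Pos → False) :
    ctx.height (w δ) = 1 := by
  refine ctx.height_simple ?_
  by_contra hb
  obtain ⟨α, hα, hsub⟩ := ctx.exists_sub_simple hw hb
  have hαP := ctx.base_subset hα
  refine hind (w.symm α) ?_ (w.symm (w δ - α)) ?_ ?_ ?_ ?_
  · rw [← h.map_mem, w.apply_symm_apply]
    exact ctx.pos_subset hαP
  · rw [← h.map_mem, w.apply_symm_apply]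
    exact ctx.pos_subset hsub
  · rw [map_sub, w.symm_apply_apply]
    abel
  · rwa [w.apply_symm_apply]
  · rwa [w.apply_symm_apply]

theorem value_theta (h : ctx.InvertsCascade K w) : ⟪ctx.θ, cascElt K⟫ = 1 :=
  h.isCascade.value_eq_one ((h.isCascade _).2 ⟨_, .top⟩)

theorem height_map_theta (h : ctx.InvertsCascade K w) : ctx.height (w ctx.θ) = -1 := by
  have h1 : ctx.height (w (-ctx.θ)) = 1 := by
    refine h.height_map_eq_one ?_ ?_
    · rw [map_neg]
      exact (h.inversion _ ctx.theta_mem).2 (.inl h.value_theta)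
    · have key : ∀ μ ν : V, ν ∈ ctx.Δ → -ctx.θ = μ + ν → μ ∈ ctx.Pos → False := by
        intro μ ν hν heq hμ
        have h3 := ctx.theta_highest (-ν) (ctx.neg_mem ν hν)
        have h4 : ctx.θ - -ν = -μ := by
          rw [neg_eq_iff_eq_neg.1 heq]
          abel
        rw [h4] at h3
        have h5 := ctx.height_pos h3
        have h6 := ctx.one_le_height hμ
        rw [map_neg] at h5
        rcases h5 with h5 | h5
        · exact ctx.pos_ne_zero hμ (neg_eq_zero.1 h5)
        · linarith
      intro μ hμ ν hν heq hwμ hwν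
      have hsum : ⟪μ, cascElt K⟫ + ⟪ν, cascElt K⟫ = -1 := by
        rw [← inner_add_left, ← heq, inner_neg_left, h.value_theta]
      rcases h.cases_of_map_pos hμ hwμ with ⟨hP, _⟩ | h1
      · exact key μ ν hν heq hP
      rcases h.cases_of_map_pos hν hwν with ⟨hP, _⟩ | h2
      · exact key ν μ hμ (heq.trans (add_comm μ ν)) hP
      rcases h1 with h1 | h1 <;> rcases h2 with h2 | h2 <;> rw [h1, h2] at hsum <;>
        norm_num at hsum
  rw [map_neg, map_neg] at h1
  linarith

theorem pos_of_value_add_eq_zero (h : ctx.InvertsCascade K w) {μ ν : V} (hμ : μ ∈ ctx.Δ)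
    (hν : ν ∈ ctx.Δ) (hwμ : w μ ∈ ctx.Pos) (hwν : w ν ∈ ctx.Pos)
    (hsum : ⟪μ + ν, cascElt K⟫ = 0) :
    (μ ∈ ctx.Pos ∧ ⟪μ, cascElt K⟫ = 0) ∧ ν ∈ ctx.Pos ∧ ⟪ν, cascElt K⟫ = 0 := by
  rw [inner_add_left] at hsum
  rcases h.cases_of_map_pos hμ hwμ with ⟨hP, h1 | h1⟩ | h1 | h1 <;>
  rcases h.cases_of_map_pos hν hwν with ⟨hQ, h2 | h2⟩ | h2 | h2 <;>
  first
  | exact ⟨⟨hP, h1⟩, hQ, h2⟩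
  | (rw [h1, h2] at hsum; norm_num at hsum)

theorem height_map_simple_zero (h : ctx.InvertsCascade K w) {α : V} (hα : α ∈ ctx.base)
    (h0 : ⟪α, cascElt K⟫ = 0) : ctx.height (w α) = 1 := by
  refine h.height_map_eq_one (h.map_pos (ctx.base_subset hα) ?_ ?_) ?_
  · rw [h0]
    norm_num
  · rw [h0]
    norm_num
  · intro μ hμ ν hν heq hwμ hwν
    obtain ⟨⟨h1, _⟩, h2, _⟩ := h.pos_of_value_add_eq_zero hμ hν hwμ hwν (heq ▸ h0)
    exact ctx.simple_ne_add hα h1 h2 heq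

theorem height_map_edge (h : ctx.InvertsCascade K w) {α β : V} (hα : α ∈ ctx.base)
    (hβ : β ∈ ctx.base) (hα1 : ⟪α, cascElt K⟫ = 1) (hβ1 : ⟪β, cascElt K⟫ = -1)
    (hadj : ⟪α, β⟫ ≠ 0) : ctx.height (w α) + ctx.height (w β) = 1 := by
  have hne : α ≠ β := by
    rintro rfl
    rw [hα1] at hβ1
    norm_num at hβ1
  have hsum := ctx.add_pos_mem (ctx.base_subset hα) (ctx.base_subset hβ)
    ((ctx.inner_simple_nonpos hα hβ hne).lt_of_ne hadj)
  have h0 : ⟪α + β, cascElt K⟫ = 0 := by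
    rw [inner_add_left, hα1, hβ1]
    norm_num
  rw [← map_add, ← map_add]
  refine h.height_map_eq_one (h.map_pos hsum ?_ ?_) ?_
  · rw [h0]
    norm_num
  · rw [h0]
    norm_num
  · intro μ hμ ν hν heq hwμ hwν
    obtain ⟨⟨hμP, hμ0⟩, hνP, hν0⟩ := h.pos_of_value_add_eq_zero hμ hν hwμ hwν (heq ▸ h0)
    have hht := congrArg ctx.height heq
    rw [map_add, map_add, ctx.height_simple hα, ctx.height_simple hβ] at hht
    have h1 := ctx.one_le_height hμP
    have h2 := ctx.one_le_height hνP
    have hμb := ctx.mem_base_of_height_lt hμP (by linarith)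
    have hνb := ctx.mem_base_of_height_lt hνP (by linarith)
    have hc := congrArg (ctx.coord α) heq
    rw [map_add, map_add, ctx.coord_self hα, ctx.coord_of_ne hα hβ hne,
      ctx.coord_of_ne hα hμb, ctx.coord_of_ne hα hνb] at hc
    · norm_num at hc
    · rintro rfl
      rw [hα1] at hν0
      norm_num at hν0
    · rintro rfl
      rw [hα1] at hμ0
      norm_num at hμ0

theorem not_adjacent_neg_one (h : ctx.InvertsCascade K w) {α β : V} (hα : α ∈ ctx.base)
    (hβ : β ∈ ctx.base) (hne : α ≠ β) (hα1 : ⟪α, cascElt K⟫ = -1)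
    (hβ1 : ⟪β, cascElt K⟫ = -1) : ⟪α, β⟫ = 0 := by
  by_contra hadj
  have h1 := h.value_cases (ctx.add_pos_mem (ctx.base_subset hα) (ctx.base_subset hβ)
    ((ctx.inner_simple_nonpos hα hβ hne).lt_of_ne hadj))
  rw [inner_add_left, hα1, hβ1] at h1
  norm_num at h1

theorem value_le_one_of_support (h : ctx.InvertsCascade K w) (hγ : γ ∈ ctx.Pos)
    (hsupp : ∀ α ∈ ctx.base, ctx.coord α γ ≠ 0 → 0 ≤ ⟪α, cascElt K⟫) :
    ⟪γ, cascElt K⟫ ≤ 1 := by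
  rcases h.value_cases hγ with h1 | h1 | h1 | h1
  · linarith
  · linarith
  · exact h1.le
  · exact absurd h1 (h.isCascade.value_ne_two hγ hsupp)

/-- The support of a positive root contains at most one simple root of value `1`, if the
simple roots in it have nonnegative values. -/
theorem eq_of_support (h : ctx.InvertsCascade K w) (hγ : γ ∈ ctx.Pos)
    (hsupp : ∀ α ∈ ctx.base, ctx.coord α γ ≠ 0 → 0 ≤ ⟪α, cascElt K⟫) {α β : V}
    (hα : α ∈ ctx.base) (hβ : β ∈ ctx.base) (hα1 : ⟪α, cascElt K⟫ = 1)
    (hβ1 : ⟪β, cascElt K⟫ = 1) (hαγ : ctx.coord α γ ≠ 0) (hβγ : ctx.coord β γ ≠ 0) :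
    α = β := by
  by_contra hne
  have h1 := h.value_le_one_of_support hγ hsupp
  have hterm : ∀ s ∈ ctx.base, 0 ≤ ctx.coord s γ * ⟪s, cascElt K⟫ := by
    intro s hs
    by_cases h0 : ctx.coord s γ = 0
    · rw [h0, zero_mul]
    · exact mul_nonneg (ctx.pos_coord_nonneg hγ s) (hsupp s hs h0)
  have h2 := Finset.sum_le_sum_of_subset_of_nonneg
    (Finset.insert_subset hα (Finset.singleton_subset_iff.2 hβ)) fun s hs _ => hterm s hs
  rw [Finset.sum_pair hne, ← ctx.inner_eq_sum_coord, hα1, hβ1, mul_one, mul_one] at h2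
  have h3 := (ctx.coord_eq_zero_or_one_le (ctx.pos_coords γ hγ) α).resolve_left hαγ
  have h4 := (ctx.coord_eq_zero_or_one_le (ctx.pos_coords γ hγ) β).resolve_left hβγ
  linarith

theorem exists_simple_value_one (h : ctx.InvertsCascade K w) :
    ∃ α ∈ ctx.base, ⟪α, cascElt K⟫ = 1 := by
  by_contra! hno
  have h1 := h.value_theta
  rw [ctx.inner_eq_sum_coord] at h1
  have h2 : ∑ α ∈ ctx.base, ctx.coord α ctx.θ * ⟪α, cascElt K⟫ ≤ 0 := by
    refine Finset.sum_nonpos fun α hα => mul_nonpos_of_nonneg_of_nonpos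
      (ctx.pos_coord_nonneg ctx.theta_mem α) ?_
    rcases h.simple_value_cases hα with h3 | h3 | h3
    · linarith
    · exact h3.le
    · exact absurd h3 (hno α hα)
  linarith

/-- Either `b` has value `-1` and its image has height `D`, or `b` is joined to a simple root of
value `1`, whose image has height `1 - D`, inside the support of a root all of whose simple
constituents have nonnegative values. -/
def Linked (ctx : RootSystemCtx V) (K : Finset V) (w : V ≃ₗ[ℝ] V) (D : ℝ) (b : V) : Prop :=
  (⟪b, cascElt K⟫ = -1 ∧ ctx.height (w b) = D) ∨
    ∃ γ ∈ ctx.Pos, (∀ α ∈ ctx.base, ctx.coord α γ ≠ 0 → 0 ≤ ⟪α, cascElt K⟫) ∧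
      ctx.coord b γ ≠ 0 ∧ ∃ a ∈ ctx.base, ⟪a, cascElt K⟫ = 1 ∧ ctx.coord a γ ≠ 0 ∧
        ctx.height (w a) = 1 - D

theorem linked_of_value_one {D : ℝ} {b : V} (hb : b ∈ ctx.base) (hb1 : ⟪b, cascElt K⟫ = 1)
    (hD : ctx.height (w b) = 1 - D) : Linked ctx K w D b := by
  have hself : ctx.coord b b ≠ 0 := by
    rw [ctx.coord_self hb]
    exact one_ne_zero
  refine .inr ⟨b, ctx.base_subset hb, fun s hs hne => ?_, hself, b, hb, hb1, hself, hD⟩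
  have : s = b := by
    by_contra h2
    exact hne (ctx.coord_of_ne hs hb h2)
  rw [this, hb1]
  exact zero_le_one

theorem height_of_linked (h : ctx.InvertsCascade K w) {D : ℝ} {b : V} (hb : b ∈ ctx.base)
    (hl : Linked ctx K w D b) :
    (⟪b, cascElt K⟫ = -1 → ctx.height (w b) = D) ∧
      (⟪b, cascElt K⟫ = 1 → ctx.height (w b) = 1 - D) := by
  rcases hl with ⟨h1, h2⟩ | ⟨γ, hγ, hsupp, hbγ, a, ha, ha1, haγ, hD⟩
  · refine ⟨fun _ => h2, fun h3 => ?_⟩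
    rw [h1] at h3
    norm_num at h3
  · refine ⟨fun h3 => ?_, fun h3 => ?_⟩
    · have := hsupp b hb hbγ
      rw [h3] at this
      norm_num at this
    · rw [h.eq_of_support hγ hsupp hb ha h3 ha1 hbγ haγ, hD]

theorem linked_step (h : ctx.InvertsCascade K w) {D : ℝ} {b b' : V} (hb : b ∈ ctx.base)
    (hb' : b' ∈ ctx.base) (hl : Linked ctx K w D b) (hadj : ⟪b, b'⟫ ≠ 0) :
    Linked ctx K w D b' := by
  by_cases hbb : b = b'
  · exact hbb ▸ hl
  have hneg : ⟪b, b'⟫ < 0 := (ctx.inner_simple_nonpos hb hb' hbb).lt_of_ne hadj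
  have hadj' : ⟪b', b⟫ ≠ 0 := real_inner_comm b' b ▸ hadj
  obtain ⟨hm, hp⟩ := h.height_of_linked hb hl
  rcases h.simple_value_cases hb' with hv' | hv'
  · rcases h.simple_value_cases hb with hv | hv | hv
    · exact absurd (h.not_adjacent_neg_one hb hb' hbb hv hv') hadj
    · exact absurd (h.isCascade.not_adjacent hb' hb hv' hv) hadj'
    · have := h.height_map_edge hb hb' hv hv' hadj
      rw [hp hv] at this
      exact .inl ⟨hv', by linarith⟩
  · rcases hl with ⟨hv, _⟩ | ⟨γ, hγ, hsupp, hbγ, a, ha, ha1, haγ, hD⟩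
    · rcases hv' with hv' | hv'
      · exact absurd (h.isCascade.not_adjacent hb hb' hv hv') hadj
      · have := h.height_map_edge hb' hb hv' hv hadj'
        rw [hm hv] at this
        exact linked_of_value_one hb' hv' (by linarith)
    · have hnn : 0 ≤ ⟪b', cascElt K⟫ := by rcases hv' with hv' | hv' <;> rw [hv']; norm_num
      by_cases hb'γ : ctx.coord b' γ = 0
      · have hlt : ⟪γ, b'⟫ < 0 := by
          rw [ctx.inner_eq_sum_coord]
          refine Finset.sum_neg' (fun s hs => ?_) ⟨b, hb, ?_⟩
          · by_cases hsb : s = b'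
            · rw [hsb, hb'γ, zero_mul]
            · exact mul_nonpos_of_nonneg_of_nonpos (ctx.pos_coord_nonneg hγ s)
                (ctx.inner_simple_nonpos hs hb' hsb)
          · exact mul_neg_of_pos_of_neg ((ctx.pos_coord_nonneg hγ b).lt_of_ne' hbγ) hneg
        have hP := ctx.add_pos_mem hγ (ctx.base_subset hb') hlt
        have hca : ctx.coord a b' = 0 := by
          refine ctx.coord_of_ne ha hb' ?_
          rintro rfl
          exact haγ hb'γ
        refine .inr ⟨γ + b', hP, fun s hs hne => ?_, ?_, a, ha, ha1, ?_, hD⟩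
        · by_cases hsb : s = b'
          · rwa [hsb]
          · rw [map_add, ctx.coord_of_ne hs hb' hsb, add_zero] at hne
            exact hsupp s hs hne
        · rw [map_add, hb'γ, ctx.coord_self hb', zero_add]
          exact one_ne_zero
        · rwa [map_add, hca, add_zero]
      · exact .inr ⟨γ, hγ, hsupp, hb'γ, a, ha, ha1, haγ, hD⟩

/-- The heights of the images of the simple roots. -/
theorem exists_height_map_simple (h : ctx.InvertsCascade K w) :
    ∃ D : ℝ, ∀ α ∈ ctx.base,
      (⟪α, cascElt K⟫ = -1 ∧ ctx.height (w α) = D) ∨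
      (⟪α, cascElt K⟫ = 0 ∧ ctx.height (w α) = 1) ∨
      (⟪α, cascElt K⟫ = 1 ∧ ctx.height (w α) = 1 - D) := by
  obtain ⟨a, ha, ha1⟩ := h.exists_simple_value_one
  refine ⟨1 - ctx.height (w a), fun α hα => ?_⟩
  have hl := ctx.base_connected (Linked ctx K w (1 - ctx.height (w a))) ha
    (linked_of_value_one ha ha1 (by ring))
    (fun b hb b' hb' => h.linked_step hb hb') α hα
  obtain ⟨hm, hp⟩ := h.height_of_linked hα hl
  rcases h.simple_value_cases hα with hv | hv | hv
  · exact .inl ⟨hv, hm hv⟩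
  · exact .inr (.inl ⟨hv, h.height_map_simple_zero hα hv⟩)
  · exact .inr (.inr ⟨hv, hp hv⟩)

end InvertsCascade

/-- `height (w δ) + (D - 1/2) (δ, x_K)`, as a linear form in `δ`. -/
noncomputable def shiftedHeight (K : Finset V) (w : V ≃ₗ[ℝ] V) (D : ℝ) : V →ₗ[ℝ] ℝ :=
  ctx.height ∘ₗ (w : V →ₗ[ℝ] V) + (D - 1 / 2) • innerₗ V (cascElt K)

theorem shiftedHeight_apply (K : Finset V) (w : V ≃ₗ[ℝ] V) (D : ℝ) (δ : V) :
    ctx.shiftedHeight K w D δ = ctx.height (w δ) + (D - 1 / 2) * ⟪δ, cascElt K⟫ := by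
  simp [shiftedHeight, real_inner_comm]

namespace InvertsCascade

variable {ctx}
variable {K : Finset V} {w : V ≃ₗ[ℝ] V} {γ : V} {D : ℝ}

theorem shiftedHeight_simple {α : V}
    (hα : (⟪α, cascElt K⟫ = -1 ∧ ctx.height (w α) = D) ∨
      (⟪α, cascElt K⟫ = 0 ∧ ctx.height (w α) = 1) ∨
      (⟪α, cascElt K⟫ = 1 ∧ ctx.height (w α) = 1 - D)) :
    1 / 2 ≤ ctx.shiftedHeight K w D α ∧
      (⟪α, cascElt K⟫ = -1 ∨ ⟪α, cascElt K⟫ = 1 → ctx.shiftedHeight K w D α = 1 / 2) := by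
  rw [shiftedHeight_apply]
  rcases hα with ⟨h1, h2⟩ | ⟨h1, h2⟩ | ⟨h1, h2⟩ <;> rw [h1, h2]
  · exact ⟨by linarith, fun _ => by ring⟩
  · norm_num
  · exact ⟨by linarith, fun _ => by ring⟩

theorem shiftedHeight_closure
    (hD : ∀ α ∈ ctx.base, 1 / 2 ≤ ctx.shiftedHeight K w D α) {v : V}
    (hv : v ∈ AddSubmonoid.closure (ctx.base : Set V)) :
    0 ≤ ctx.shiftedHeight K w D v ∧ (v ≠ 0 → 1 / 2 ≤ ctx.shiftedHeight K w D v) := by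
  induction hv using AddSubmonoid.closure_induction with
  | mem x hx => exact ⟨by linarith [hD x hx], fun _ => hD x hx⟩
  | zero => simp
  | add x y _ _ hx hy =>
    rw [map_add]
    refine ⟨add_nonneg hx.1 hy.1, fun hne => ?_⟩
    by_cases h0 : x = 0
    · have hy0 : y ≠ 0 := by
        rintro rfl
        exact hne (by rw [h0, add_zero])
      linarith [hy.2 hy0, hx.1]
    · linarith [hx.2 h0, hy.1]

theorem shiftedHeight_bounds (h : ctx.InvertsCascade K w)
    (hD : ∀ α ∈ ctx.base, 1 / 2 ≤ ctx.shiftedHeight K w D α) (hγ : γ ∈ ctx.Pos) :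
    1 / 2 ≤ ctx.shiftedHeight K w D γ ∧ ctx.shiftedHeight K w D γ ≤ D - 3 / 2 ∧
      (ctx.shiftedHeight K w D γ = 1 / 2 → γ ∈ ctx.base) := by
  refine ⟨(shiftedHeight_closure hD (ctx.pos_coords γ hγ)).2 (ctx.pos_ne_zero hγ), ?_, ?_⟩
  · have h1 := (shiftedHeight_closure hD (ctx.theta_highest γ (ctx.pos_subset hγ))).1
    rw [map_sub, shiftedHeight_apply _ _ _ _ ctx.θ, h.height_map_theta, h.value_theta] at h1
    linarith
  · intro heq
    by_contra hb
    obtain ⟨α, hα, hsub⟩ := ctx.exists_sub_simple hγ hb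
    have h1 := (shiftedHeight_closure hD (ctx.pos_coords _ hsub)).2 (ctx.pos_ne_zero hsub)
    rw [map_sub, heq] at h1
    linarith [hD α hα]

/-- The heights of the positive roots, read off before applying `w`. -/
theorem height_cases (h : ctx.InvertsCascade K w)
    (hD : ∀ α ∈ ctx.base,
      (⟪α, cascElt K⟫ = -1 ∧ ctx.height (w α) = D) ∨
      (⟪α, cascElt K⟫ = 0 ∧ ctx.height (w α) = 1) ∨
      (⟪α, cascElt K⟫ = 1 ∧ ctx.height (w α) = 1 - D)) (hγ : γ ∈ ctx.Pos) :
    ∃ δ ∈ ctx.Pos,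
      (⟪δ, cascElt K⟫ = -1 ∧ γ = w δ ∧ D ≤ ctx.height γ ∧ (ctx.height γ = D → δ ∈ ctx.base)) ∨
      (⟪δ, cascElt K⟫ = 2 ∧ γ = -(w δ) ∧ D < ctx.height γ) ∨
      (⟪δ, cascElt K⟫ = 0 ∧ γ = w δ ∧ ctx.height γ < D - 1) ∨
      (⟪δ, cascElt K⟫ = 1 ∧ γ = -(w δ) ∧ ctx.height γ ≤ D - 1 ∧
        (ctx.height γ = D - 1 → δ ∈ ctx.base)) := by
  have hD' := fun α hα => (shiftedHeight_simple (hD α hα)).1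
  have hδ : w.symm γ ∈ ctx.Δ := by
    rw [← h.map_mem, w.apply_symm_apply]
    exact ctx.pos_subset hγ
  have hwδ := w.apply_symm_apply γ
  generalize w.symm γ = δ at hδ hwδ
  rcases ctx.pos_or_neg δ hδ with hP | hP
  · have hnot := mt (h.inversion δ hP).2 (ctx.pos_not_neg _ (hwδ ▸ hγ))
    obtain ⟨h1, h2, h3⟩ := h.shiftedHeight_bounds hD' hP
    rw [shiftedHeight_apply, hwδ] at h1 h2 h3
    refine ⟨δ, hP, ?_⟩
    rcases h.value_cases hP with hv | hv | hv | hv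
    · rw [hv] at h1 h2 h3
      exact .inl ⟨hv, hwδ.symm, by linarith, fun h4 => h3 (by linarith)⟩
    · rw [hv] at h1 h2
      exact .inr (.inr (.inl ⟨hv, hwδ.symm, by linarith⟩))
    · exact absurd (.inl hv) hnot
    · exact absurd (.inr hv) hnot
  · have hw' : γ = -(w (-δ)) := by rw [map_neg, neg_neg, hwδ]
    have hv := (h.inversion (-δ) hP).1 (hw' ▸ hγ)
    obtain ⟨h1, h2, h3⟩ := h.shiftedHeight_bounds hD' hP
    rw [shiftedHeight_apply] at h1 h2 h3
    have hht : ctx.height (w (-δ)) = -ctx.height γ := by rw [map_neg, map_neg, hwδ]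
    rw [hht] at h1 h2 h3
    refine ⟨-δ, hP, ?_⟩
    rcases hv with hv | hv
    · rw [hv] at h1 h2 h3
      exact .inr (.inr (.inr ⟨hv, hw', by linarith, fun h4 => h3 (by linarith)⟩))
    · rw [hv] at h1 h2
      exact .inr (.inl ⟨hv, hw', by linarith⟩)

/-- The height of the images of the simple roots of value `-1`, in terms of the coefficients of
the highest root. -/
theorem eq_one_add_sum (h : ctx.InvertsCascade K w)
    (hD : ∀ α ∈ ctx.base,
      (⟪α, cascElt K⟫ = -1 ∧ ctx.height (w α) = D) ∨
      (⟪α, cascElt K⟫ = 0 ∧ ctx.height (w α) = 1) ∨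
      (⟪α, cascElt K⟫ = 1 ∧ ctx.height (w α) = 1 - D)) :
    D = 1 + ∑ α ∈ ctx.base,
      (if ⟪α, cascElt K⟫ = 0 ∨ ⟪α, cascElt K⟫ = 1 then ctx.coord α ctx.θ else 0) := by
  have h1 := h.height_map_theta
  have h2 := h.value_theta
  rw [ctx.inner_eq_sum_coord] at h2
  have h3 := ctx.map_eq_sum_coord (ctx.height ∘ₗ (w : V →ₗ[ℝ] V)) ctx.θ
  simp only [LinearMap.comp_apply, LinearEquiv.coe_coe, h1] at h3
  have h4 : ∑ α ∈ ctx.base, ctx.coord α ctx.θ * ctx.height (w α) =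
      ∑ α ∈ ctx.base, (-D * (ctx.coord α ctx.θ * ⟪α, cascElt K⟫) +
        if ⟪α, cascElt K⟫ = 0 ∨ ⟪α, cascElt K⟫ = 1 then ctx.coord α ctx.θ else 0) := by
    refine Finset.sum_congr rfl fun α hα => ?_
    rcases hD α hα with ⟨hv, hr⟩ | ⟨hv, hr⟩ | ⟨hv, hr⟩ <;> rw [hv, hr]
    · rw [if_neg (by norm_num)]
      ring
    · rw [if_pos (.inl rfl)]
      ring
    · rw [if_pos (.inr rfl)]
      ring
  rw [Finset.sum_add_distrib, ← Finset.mul_sum, h2, ← h3] at h4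
  linarith

end InvertsCascade

theorem coord_sum_smul {α : V} (hα : α ∈ ctx.base) (c : V → ℝ) :
    ctx.coord α (∑ β ∈ ctx.base, c β • β) = c α := by
  rw [map_sum, Finset.sum_eq_single_of_mem α hα]
  · rw [map_smul, ctx.coord_self hα, smul_eq_mul, mul_one]
  · intro β hβ hne
    rw [map_smul, ctx.coord_of_ne hα hβ hne.symm, smul_zero]

end RootSystemCtx


/-- With `d_K = ht(θ) + 1 - Σ_{α ∈ Π_K(-1)} [θ:α] = 1 + Σ_{α ∈ Π_K(0) ∪ Π_K(1)} [θ:α]`: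
(i) `ht(γ) = d_K` iff `w_K⁻¹(γ) ∈ Π_K(-1)`; (ii) `ht(γ) = d_K - 1` iff
`-w_K⁻¹(γ) ∈ Π_K(1)`; (iii) `Δ(a_K) = {γ ∈ Δ⁺ : ht(γ) ≥ d_K}`. -/
theorem ideal_by_height {V : Type*} [NormedAddCommGroup V] [InnerProductSpace ℝ V]
    [FiniteDimensional ℝ V] (ctx : RootSystemCtx V)
    (K : Finset V) (hK : ctx.IsCascade K)
    (hA : ¬ ∃ p, 1 ≤ p ∧ ctx.IsTypeA (2 * p))
    (w : V ≃ₗ[ℝ] V) (hw : w ∈ ctx.weylGroup)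
    (hN : ∀ γ ∈ ctx.Pos,
      (-(w γ) ∈ ctx.Pos ↔ (⟪γ, cascElt K⟫ = 1 ∨ ⟪γ, cascElt K⟫ = 2)))
    (coeff : V → V → ℝ) (hcoeff : ∀ γ ∈ ctx.Δ, γ = ∑ α ∈ ctx.base, coeff γ α • α) :
    ∀ ht : V → ℝ, (∀ γ, ht γ = ∑ α ∈ ctx.base, coeff γ α) →
    ∀ dK : ℝ,
      dK = ht ctx.θ + 1 -
        ∑ α ∈ ctx.base, (if ⟪α, cascElt K⟫ = -1 then coeff ctx.θ α else 0) →
      (dK = 1 + ∑ α ∈ ctx.base,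
        (if ⟪α, cascElt K⟫ = 0 ∨ ⟪α, cascElt K⟫ = 1 then coeff ctx.θ α else 0)) ∧
      (∀ γ ∈ ctx.Pos, (ht γ = dK ↔ ∃ α ∈ ctx.base, ⟪α, cascElt K⟫ = -1 ∧ γ = w α)) ∧
      (∀ γ ∈ ctx.Pos,
        (ht γ = dK - 1 ↔ ∃ α ∈ ctx.base, ⟪α, cascElt K⟫ = 1 ∧ γ = -(w α))) ∧
      (ctx.idealSet w (cascElt K) = {γ : V | γ ∈ ctx.Pos ∧ dK ≤ ht γ}) := by
  intro ht hht dK hdK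
  have h : ctx.InvertsCascade K w := ⟨hK, ctx.map_mem_of_mem_weylGroup hw, hN⟩
  obtain ⟨D, hD⟩ := h.exists_height_map_simple
  have hco : ∀ γ ∈ ctx.Δ, ∀ α ∈ ctx.base, coeff γ α = ctx.coord α γ := by
    intro γ hγ α hα
    conv_rhs => rw [hcoeff γ hγ]
    exact (ctx.coord_sum_smul hα _).symm
  have hheight : ∀ γ ∈ ctx.Δ, ht γ = ctx.height γ := by
    intro γ hγ
    rw [hht, ctx.height_apply]
    exact Finset.sum_congr rfl (hco γ hγ)
  have hθ := ctx.pos_subset ctx.theta_mem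
  have hfirst : dK = 1 + ∑ α ∈ ctx.base,
      (if ⟪α, cascElt K⟫ = 0 ∨ ⟪α, cascElt K⟫ = 1 then coeff ctx.θ α else 0) := by
    rw [hdK, hht, add_comm, add_sub_assoc, ← Finset.sum_sub_distrib]
    congr 1
    refine Finset.sum_congr rfl fun α hα => ?_
    rcases h.simple_value_cases hα with hv | hv | hv <;> rw [hv] <;> norm_num
  have hdD : dK = D := by
    rw [hfirst, h.eq_one_add_sum hD]
    congr 1
    refine Finset.sum_congr rfl fun α hα => ?_
    rw [hco _ hθ α hα]
  clear hdK
  refine ⟨hfirst, fun γ hγ => ?_, fun γ hγ => ?_, ?_⟩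
  · rw [hheight γ (ctx.pos_subset hγ), hdD]
    constructor
    · intro heq
      obtain ⟨δ, -, ⟨hv, hw, -, hb⟩ | ⟨-, -, hlt⟩ | ⟨-, -, hlt⟩ | ⟨-, -, hlt, -⟩⟩ :=
        h.height_cases hD hγ
      · exact ⟨δ, hb heq, hv, hw⟩
      all_goals exfalso; linarith
    · rintro ⟨α, hα, hv, rfl⟩
      rcases hD α hα with ⟨-, hr⟩ | ⟨hv', -⟩ | ⟨hv', -⟩
      · exact hr
      all_goals rw [hv] at hv'; norm_num at hv'
  · rw [hheight γ (ctx.pos_subset hγ), hdD]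
    constructor
    · intro heq
      obtain ⟨δ, -, ⟨-, -, hlt, -⟩ | ⟨-, -, hlt⟩ | ⟨-, -, hlt⟩ | ⟨hv, hw, -, hb⟩⟩ :=
        h.height_cases hD hγ
      · exfalso; linarith
      · exfalso; linarith
      · exfalso; linarith
      · exact ⟨δ, hb heq, hv, hw⟩
    · rintro ⟨α, hα, hv, rfl⟩
      rcases hD α hα with ⟨hv', -⟩ | ⟨hv', -⟩ | ⟨-, hr⟩
      · rw [hv] at hv'; norm_num at hv'
      · rw [hv] at hv'; norm_num at hv'
      · rw [map_neg, hr]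
        ring
  · ext γ
    simp only [RootSystemCtx.idealSet, Set.mem_ofPred_eq]
    constructor
    · intro hmem
      have hγ : γ ∈ ctx.Pos := by
        obtain ⟨δ, hδ, ⟨hv, rfl⟩ | ⟨hv, rfl⟩⟩ := hmem
        · exact h.map_pos hδ (by rw [hv]; norm_num) (by rw [hv]; norm_num)
        · exact (hN δ hδ).2 (.inr hv)
      refine ⟨hγ, ?_⟩
      rw [hheight γ (ctx.pos_subset hγ), hdD]
      obtain ⟨δ', hδ', h'⟩ := h.height_cases hD hγ
      rcases h' with ⟨-, -, hle, -⟩ | ⟨-, -, hlt⟩ | ⟨hv', hw', -⟩ | ⟨hv', hw', -⟩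
      · exact hle
      · exact hlt.le
      all_goals
        exfalso
        obtain ⟨δ, hδ, ⟨hv, hw''⟩ | ⟨hv, hw''⟩⟩ := hmem
        all_goals
          rw [hw''] at hw'
          first
          | have heq := w.injective hw'
            rw [heq, hv'] at hv
            norm_num at hv
          | have heq := w.injective (neg_injective hw')
            rw [heq, hv'] at hv
            norm_num at hv
          | rw [← map_neg] at hw'
            have heq := w.injective hw'
            rw [← heq] at hδ'
            exact ctx.pos_not_neg _ hδ hδ'
          | rw [← map_neg] at hw'
            have heq := w.injective hw'
            rw [heq] at hδ
            exact ctx.pos_not_neg _ hδ' hδ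
    · rintro ⟨hγ, hle⟩
      rw [hheight γ (ctx.pos_subset hγ), hdD] at hle
      obtain ⟨δ, hδ, ⟨hv, hw, -⟩ | ⟨hv, hw, -⟩ | ⟨-, -, hlt⟩ | ⟨-, -, hlt, -⟩⟩ :=
        h.height_cases hD hγ
      · exact ⟨δ, hδ, .inl ⟨hv, hw⟩⟩
      · exact ⟨δ, hδ, .inr ⟨hv, hw⟩⟩
      all_goals exfalso; linarith
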